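/- arXiv:1807.07731 — 4 statements merged into one kernel-verified Lean document; each statement's English description precedes it below -/
import Mathlib

section
/- Let 0 < α < 1 and λ ∈ ℂ, and define y(x) = y₀ · E_α(−λ x^α) for x ≥ 0, where y₀ ∈ ℂ. Then for every x > 0 the Caputo fractional derivative of y of order α exists and satisfies (₀^C D_x^α y)(x) + λ y(x) = 0; moreover y(0) = y₀. -/
open MeasureTheory intervalIntegral

/-- The two-parameter Mittag-Leffler function `E_{α,β}(z) = ∑_{k=0}^∞ z^k / Γ(αk + β)`. -/
noncomputable def mittagLeffler (α β : ℝ) (z : ℂ) : ℂ :=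
  ∑' k : ℕ, z ^ k / Complex.Gamma (α * k + β)

/-- The Caputo fractional derivative of order `α ∈ (0,1)` (lower terminal `0`):
`(₀^C D_t^α f)(t) = (1/Γ(1−α)) ∫₀^t (t−τ)^{−α} f′(τ) dτ`. -/
noncomputable def caputoDeriv (α : ℝ) (f : ℝ → ℂ) (t : ℝ) : ℂ :=
  (1 / Complex.Gamma (1 - α)) *
    ∫ τ in (0 : ℝ)..t, (((t - τ) ^ (-α) : ℝ) : ℂ) * deriv f τ

open Filter Set

theorem Real.exp_neg_mul_rpow_le_Gamma {A x : ℝ} (hA : 0 ≤ A) (hx : 1 ≤ x) :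
    Real.exp (-A) * A ^ (x - 1) ≤ Real.Gamma x := by
  have hint := Real.GammaIntegral_convergent (zero_lt_one.trans_le hx)
  have hsub : Ioi A ⊆ Ioi 0 := Ioi_subset_Ioi hA
  calc Real.exp (-A) * A ^ (x - 1) = ∫ t in Ioi A, Real.exp (-t) * A ^ (x - 1) := by
        rw [MeasureTheory.integral_mul_const, integral_exp_neg_Ioi]
    _ ≤ ∫ t in Ioi A, Real.exp (-t) * t ^ (x - 1) := by
        refine setIntegral_mono_on ((integrableOn_exp_neg_Ioi A).mul_const _)
          (hint.mono_set hsub) measurableSet_Ioi fun t ht => ?_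
        have := sub_nonneg.2 hx
        have := le_of_lt (mem_Ioi.1 ht)
        gcongr
    _ ≤ ∫ t in Ioi 0, Real.exp (-t) * t ^ (x - 1) := by
        refine setIntegral_mono_set hint ?_ hsub.eventuallyLE
        filter_upwards [ae_restrict_mem measurableSet_Ioi] with t ht
        exact mul_nonneg (Real.exp_pos _).le (Real.rpow_nonneg (le_of_lt ht) _)
    _ = Real.Gamma x := (Real.Gamma_eq_integral (zero_lt_one.trans_le hx)).symm

theorem summable_pow_div_Gamma {α β : ℝ} (hα : 0 < α) (R : ℝ) :
    Summable fun k : ℕ => R ^ k / Real.Gamma (α * k + β) := by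
  set B : ℝ := 2 * |R| + 1
  have hB : 0 < B := by positivity
  set A : ℝ := B ^ α⁻¹
  have hA : 0 < A := by positivity
  have hlim : Tendsto (fun k : ℕ => α * (k : ℝ) + β) atTop atTop :=
    tendsto_atTop_add_const_right _ _ (tendsto_natCast_atTop_atTop.const_mul_atTop hα)
  refine Summable.of_norm_bounded_eventually_nat
    (g := fun k => (Real.exp A * A ^ (1 - β)) * (1 / 2) ^ k)
    (summable_geometric_two.mul_left _) ?_
  filter_upwards [hlim.eventually_ge_atTop 1] with k hk
  have hG := Real.exp_neg_mul_rpow_le_Gamma hA.le hk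
  have hGpos : 0 < Real.Gamma (α * k + β) := Real.Gamma_pos_of_pos (by linarith)
  have hAk : A ^ (α * k + β - 1) * A ^ (1 - β) = B ^ k := by
    rw [← Real.rpow_add hA, show α * k + β - 1 + (1 - β) = α * k by ring, Real.rpow_mul hA.le,
      Real.rpow_natCast, ← Real.rpow_mul hB.le, inv_mul_cancel₀ hα.ne', Real.rpow_one]
  have hR : |R| ^ k ≤ B ^ k * (1 / 2) ^ k := by
    rw [← mul_pow]
    gcongr
    simp only [B]
    linarith
  rw [norm_div, norm_pow, Real.norm_eq_abs, Real.norm_of_nonneg hGpos.le, div_le_iff₀ hGpos]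
  calc |R| ^ k ≤ B ^ k * (1 / 2) ^ k := hR
    _ = (Real.exp A * A ^ (1 - β)) * (1 / 2) ^ k *
        (Real.exp (-A) * A ^ (α * k + β - 1)) := by
        rw [← hAk, Real.exp_neg]
        field_simp
    _ ≤ _ := by gcongr

theorem norm_mittagLeffler_term {α β : ℝ} (hα : 0 ≤ α) (hβ : 0 < β) (z : ℂ) (k : ℕ) :
    ‖z ^ k / Complex.Gamma (α * k + β)‖ = ‖z‖ ^ k / Real.Gamma (α * k + β) := by
  have : Complex.Gamma (α * k + β) = (Real.Gamma (α * k + β) : ℂ) := by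
    rw [← Complex.Gamma_ofReal]
    push_cast
    rfl
  rw [this, norm_div, norm_pow, Complex.norm_of_nonneg]
  exact (Real.Gamma_pos_of_pos (by positivity)).le

theorem hasSum_mittagLeffler {α β : ℝ} (hα : 0 < α) (hβ : 0 < β) (z : ℂ) :
    HasSum (fun k : ℕ => z ^ k / Complex.Gamma (α * k + β)) (mittagLeffler α β z) := by
  refine (Summable.of_norm ?_).hasSum
  simp_rw [norm_mittagLeffler_term hα.le hβ]
  exact summable_pow_div_Gamma hα _

theorem mittagLeffler_zero (α β : ℝ) : mittagLeffler α β 0 = 1 / Complex.Gamma β := by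
  rw [mittagLeffler, tsum_eq_single 0 fun k hk => by simp [hk]]
  simp

theorem continuous_mittagLeffler {α β : ℝ} (hα : 0 < α) (hβ : 0 < β) :
    Continuous (mittagLeffler α β) := by
  refine continuous_iff_continuousAt.2 fun z => ?_
  refine ContinuousOn.continuousAt (s := Metric.ball 0 (‖z‖ + 1)) ?_
    (Metric.isOpen_ball.mem_nhds (by simp))
  refine continuousOn_tsum (fun k => by fun_prop)
    (summable_pow_div_Gamma (β := β) hα (‖z‖ + 1)) fun k w hw => ?_
  rw [norm_mittagLeffler_term hα.le hβ]
  have := Real.Gamma_pos_of_pos (show 0 < α * k + β by positivity)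
  gcongr
  exact (mem_ball_zero_iff.1 hw).le

theorem hasDerivAt_mittagLeffler_one {α : ℝ} (hα : 0 < α) (z : ℂ) :
    HasDerivAt (mittagLeffler α 1) (mittagLeffler α α z / α) z := by
  have hα' : (α : ℂ) ≠ 0 := Complex.ofReal_ne_zero.2 hα.ne'
  have hzero : (0 : ℂ) ∈ Metric.ball (0 : ℂ) (‖z‖ + 1) := by simp; positivity
  have key : HasDerivAt
      (fun w : ℂ => ∑' k : ℕ, w ^ (k + 1) / Complex.Gamma (α * (k + 1 : ℕ) + (1 : ℝ)))
      (∑' k : ℕ, z ^ k / Complex.Gamma (α * k + α) / α) z := by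
    refine hasDerivAt_tsum_of_isPreconnected
      (g := fun (k : ℕ) (w : ℂ) => w ^ (k + 1) / Complex.Gamma (α * (k + 1 : ℕ) + (1 : ℝ)))
      (g' := fun (k : ℕ) (w : ℂ) => w ^ k / Complex.Gamma (α * k + α) / α)
      ((summable_pow_div_Gamma (β := α) hα (‖z‖ + 1)).div_const α) Metric.isOpen_ball
      (convex_ball (0 : ℂ) (‖z‖ + 1)).isPreconnected (fun k w _ => ?_) (fun k w hw => ?_)
      hzero ?_ (mem_ball_zero_iff.2 (lt_add_one _))
    · have hne : (α * (k + 1) : ℂ) ≠ 0 := mul_ne_zero hα' (Nat.cast_add_one_ne_zero k)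
      convert! (hasDerivAt_pow (k + 1) w).div_const
        (Complex.Gamma (α * (k + 1 : ℕ) + (1 : ℝ))) using 1
      push_cast
      rw [Complex.Gamma_add_one _ hne, show (α * k + α : ℂ) = α * (k + 1) by ring]
      have := Nat.cast_add_one_ne_zero (R := ℂ) k
      field_simp
    · rw [norm_div, norm_mittagLeffler_term hα.le hα, Complex.norm_of_nonneg hα.le]
      have := Real.Gamma_pos_of_pos (show 0 < α * k + α by positivity)
      gcongr
      exact (mem_ball_zero_iff.1 hw).le
    · simp
  rw [tsum_div_const] at key
  convert! key.const_add (1 : ℂ) using 1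
  ext w
  rw [mittagLeffler, (hasSum_mittagLeffler hα one_pos w).summable.tsum_eq_zero_add]
  simp

theorem hasDerivAt_mittagLeffler_mul_rpow {α : ℝ} (hα : 0 < α) (c : ℂ) {t : ℝ} (ht : 0 < t) :
    HasDerivAt (fun s : ℝ => mittagLeffler α 1 (c * ((s ^ α : ℝ) : ℂ)))
      (c * ((t ^ (α - 1) : ℝ) : ℂ) * mittagLeffler α α (c * ((t ^ α : ℝ) : ℂ))) t := by
  have hα' : (α : ℂ) ≠ 0 := Complex.ofReal_ne_zero.2 hα.ne'
  have h := ((Real.hasDerivAt_rpow_const (p := α) (Or.inl ht.ne')).ofReal_comp).const_mul c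
  convert! (hasDerivAt_mittagLeffler_one hα _).comp t h using 1
  push_cast
  field_simp

theorem integral_rpow_mul_sub_rpow {a b x : ℝ} (ha : 0 < a) (hb : 0 < b) (hx : 0 < x) :
    ∫ τ in (0 : ℝ)..x, τ ^ (a - 1) * (x - τ) ^ (b - 1) =
      x ^ (a + b - 1) * (Real.Gamma a * Real.Gamma b / Real.Gamma (a + b)) := by
  have hG : (Real.Gamma (a + b) : ℂ) ≠ 0 :=
    Complex.ofReal_ne_zero.2 (Real.Gamma_pos_of_pos (by positivity)).ne'
  have hbeta : Complex.betaIntegral a b =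
      ((Real.Gamma a * Real.Gamma b / Real.Gamma (a + b) : ℝ) : ℂ) := by
    have h := Complex.Gamma_mul_Gamma_eq_betaIntegral (s := a) (t := b) (by simpa) (by simpa)
    rw [← Complex.ofReal_add, Complex.Gamma_ofReal, Complex.Gamma_ofReal,
      Complex.Gamma_ofReal] at h
    push_cast
    rw [h, mul_div_cancel_left₀ _ hG]
  have h := Complex.betaIntegral_scaled a b hx
  rw [hbeta] at h
  rw [← Complex.ofReal_inj, ← intervalIntegral.integral_ofReal, Complex.ofReal_mul,
    Complex.ofReal_cpow hx.le]
  push_cast at h ⊢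
  rw [← h]
  refine intervalIntegral.integral_congr fun τ hτ => ?_
  rw [uIcc_of_le hx.le] at hτ
  rw [Complex.ofReal_cpow hτ.1, Complex.ofReal_cpow (sub_nonneg.2 hτ.2)]
  push_cast
  rfl

theorem intervalIntegrable_rpow_mul_sub_rpow {a b x : ℝ} (ha : 0 < a) (hb : 0 < b) (hx : 0 < x) :
    IntervalIntegrable (fun τ : ℝ => τ ^ (a - 1) * (x - τ) ^ (b - 1)) volume 0 x := by
  refine intervalIntegrable_of_integral_ne_zero ?_
  rw [integral_rpow_mul_sub_rpow ha hb hx]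
  have := Real.Gamma_pos_of_pos ha
  have := Real.Gamma_pos_of_pos hb
  have := Real.Gamma_pos_of_pos (add_pos ha hb)
  positivity

theorem intervalIntegrable_kernel_mul_mittagLeffler {α a b x : ℝ} (hα : 0 < α) (ha : 0 < a)
    (hb : 0 < b) (hx : 0 < x) (c : ℂ) :
    IntervalIntegrable (fun τ : ℝ => ((τ ^ (a - 1) * (x - τ) ^ (b - 1) : ℝ) : ℂ) *
      mittagLeffler α a (c * ((τ ^ α : ℝ) : ℂ))) volume 0 x := by
  have hK := intervalIntegrable_rpow_mul_sub_rpow ha hb hx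
  refine IntervalIntegrable.mul_continuousOn
    ⟨hK.1.ofReal, hK.2.ofReal⟩ (Continuous.continuousOn ?_)
  exact (continuous_mittagLeffler hα ha).comp (continuous_const.mul
    (Complex.continuous_ofReal.comp (Real.continuous_rpow_const hα.le)))

theorem integral_kernel_mul_pow {α a b x : ℝ} (hα : 0 < α) (ha : 0 < a) (hb : 0 < b)
    (hx : 0 < x) (c : ℂ) (k : ℕ) :
    ∫ τ in (0 : ℝ)..x, ((τ ^ (a - 1) * (x - τ) ^ (b - 1) : ℝ) : ℂ) *
        ((c * ((τ ^ α : ℝ) : ℂ)) ^ k / Complex.Gamma (α * k + a)) =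
      Complex.Gamma b * ((x ^ (a + b - 1) : ℝ) : ℂ) *
        ((c * ((x ^ α : ℝ) : ℂ)) ^ k / Complex.Gamma (α * k + (a + b : ℝ))) := by
  have hs : 0 < α * k + a := by positivity
  have hcongr : ∀ τ ∈ Ioc 0 x, ((τ ^ (a - 1) * (x - τ) ^ (b - 1) : ℝ) : ℂ) *
        ((c * ((τ ^ α : ℝ) : ℂ)) ^ k / Complex.Gamma (α * k + a)) =
      ((τ ^ (α * k + a - 1) * (x - τ) ^ (b - 1) : ℝ) : ℂ) *
        (c ^ k / Complex.Gamma (α * k + a)) := fun τ hτ => by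
    rw [show α * k + a - 1 = a - 1 + α * k by ring, Real.rpow_add hτ.1, Real.rpow_mul hτ.1.le,
      Real.rpow_natCast]
    push_cast
    ring
  rw [intervalIntegral.integral_of_le hx.le, setIntegral_congr_fun measurableSet_Ioc hcongr,
    ← intervalIntegral.integral_of_le hx.le, intervalIntegral.integral_mul_const,
    intervalIntegral.integral_ofReal, integral_rpow_mul_sub_rpow hs hb hx,
    show α * k + a + b - 1 = a + b - 1 + α * k by ring, Real.rpow_add hx, Real.rpow_mul hx.le,
    Real.rpow_natCast, show (α * k + a : ℂ) = (α * k + a : ℝ) by push_cast; rfl,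
    show (α * k + (a + b : ℝ) : ℂ) = (α * k + a + b : ℝ) by push_cast; ring,
    Complex.Gamma_ofReal, Complex.Gamma_ofReal, Complex.Gamma_ofReal]
  have h₁ : (Real.Gamma (α * k + a) : ℂ) ≠ 0 :=
    Complex.ofReal_ne_zero.2 (Real.Gamma_pos_of_pos hs).ne'
  have h₂ : (Real.Gamma (α * k + a + b) : ℂ) ≠ 0 :=
    Complex.ofReal_ne_zero.2 (Real.Gamma_pos_of_pos (by positivity)).ne'
  push_cast
  field_simp
  ring

theorem integral_kernel_mul_mittagLeffler {α a b x : ℝ} (hα : 0 < α) (ha : 0 < a)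
    (hb : 0 < b) (hx : 0 < x) (c : ℂ) :
    ∫ τ in (0 : ℝ)..x, ((τ ^ (a - 1) * (x - τ) ^ (b - 1) : ℝ) : ℂ) *
        mittagLeffler α a (c * ((τ ^ α : ℝ) : ℂ)) =
      Complex.Gamma b * ((x ^ (a + b - 1) : ℝ) : ℂ) *
        mittagLeffler α (a + b) (c * ((x ^ α : ℝ) : ℂ)) := by
  have hK := intervalIntegrable_rpow_mul_sub_rpow ha hb hx
  have hsum := summable_pow_div_Gamma (β := a) hα (‖c‖ * x ^ α)
  have key := intervalIntegral.hasSum_integral_of_dominated_convergence (μ := volume)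
    (a := 0) (b := x)
    (F := fun (k : ℕ) (τ : ℝ) => ((τ ^ (a - 1) * (x - τ) ^ (b - 1) : ℝ) : ℂ) *
      ((c * ((τ ^ α : ℝ) : ℂ)) ^ k / Complex.Gamma (α * k + a)))
    (f := fun τ : ℝ => ((τ ^ (a - 1) * (x - τ) ^ (b - 1) : ℝ) : ℂ) *
      mittagLeffler α a (c * ((τ ^ α : ℝ) : ℂ)))
    (fun k τ => ‖τ ^ (a - 1) * (x - τ) ^ (b - 1)‖ *
      ((‖c‖ * x ^ α) ^ k / Real.Gamma (α * k + a)))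
    (fun k => Measurable.aestronglyMeasurable (by fun_prop))
    (fun k => ae_of_all _ fun τ hτ => ?_)
    (ae_of_all _ fun τ _ => hsum.mul_left _)
    (by simpa only [tsum_mul_left] using hK.norm.mul_const _)
    (ae_of_all _ fun τ _ => (hasSum_mittagLeffler hα ha _).mul_left _)
  · simp_rw [integral_kernel_mul_pow hα ha hb hx c] at key
    exact key.unique ((hasSum_mittagLeffler hα (add_pos ha hb) _).mul_left _)
  · rw [uIoc_of_le hx.le] at hτ
    rw [norm_mul, norm_mittagLeffler_term hα.le ha, Complex.norm_real, norm_mul c,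
      Complex.norm_of_nonneg (Real.rpow_nonneg hτ.1.le _)]
    have := Real.Gamma_pos_of_pos (show 0 < α * k + a by positivity)
    have := hτ.1.le
    have := hτ.2
    gcongr

/-- For `0 < α < 1`, `λ ∈ ℂ`, the function `y(x) = y₀ E_α(−λ x^α)` satisfies
`y(0) = y₀`, and for every `x > 0` the Caputo derivative of order `α` of `y` exists
(the defining integral converges) and `(₀^C D_x^α y)(x) + λ y(x) = 0`. -/
theorem caputo_homogeneous_solution (α : ℝ) (hα₀ : 0 < α) (hα₁ : α < 1)
    (lam y₀ : ℂ) (y : ℝ → ℂ)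
    (hy : ∀ x : ℝ, y x = y₀ * mittagLeffler α 1 (-lam * ((x ^ α : ℝ) : ℂ))) :
    y 0 = y₀ ∧
      ∀ x : ℝ, 0 < x →
        IntervalIntegrable (fun τ : ℝ => (((x - τ) ^ (-α) : ℝ) : ℂ) * deriv y τ)
          volume 0 x ∧
        caputoDeriv α y x + lam * y x = 0 := by
  obtain rfl : y = fun x : ℝ => y₀ * mittagLeffler α 1 (-lam * ((x ^ α : ℝ) : ℂ)) := funext hy
  refine ⟨by simp [Real.zero_rpow hα₀.ne', mittagLeffler_zero], fun x hx => ?_⟩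
  have hb : 0 < 1 - α := sub_pos.2 hα₁
  set K : ℝ → ℂ := fun τ => ((τ ^ (α - 1) * (x - τ) ^ (1 - α - 1) : ℝ) : ℂ) *
    mittagLeffler α α (-lam * ((τ ^ α : ℝ) : ℂ)) with hKdef
  have hcongr : EqOn (fun τ => (y₀ * -lam) * K τ) (fun τ : ℝ => (((x - τ) ^ (-α) : ℝ) : ℂ) *
      deriv (fun x : ℝ => y₀ * mittagLeffler α 1 (-lam * ((x ^ α : ℝ) : ℂ))) τ) (Ioc 0 x) := by
    intro τ hτ
    simp only [hKdef]
    rw [((hasDerivAt_mittagLeffler_mul_rpow hα₀ (-lam) hτ.1).const_mul y₀).deriv,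
      show 1 - α - 1 = -α by ring]
    push_cast
    ring
  refine ⟨?_, ?_⟩
  · refine IntervalIntegrable.congr (f := fun τ => (y₀ * -lam) * K τ) ?_
      ((intervalIntegrable_kernel_mul_mittagLeffler hα₀ hα₀ hb hx (-lam)).const_mul _)
    rwa [uIoc_of_le hx.le]
  · have hG : Complex.Gamma (1 - α) ≠ 0 :=
      Complex.Gamma_ne_zero_of_re_pos (by simpa using hα₁)
    rw [caputoDeriv, intervalIntegral.integral_of_le hx.le,
      ← setIntegral_congr_fun measurableSet_Ioc hcongr, ← intervalIntegral.integral_of_le hx.le,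
      intervalIntegral.integral_const_mul, integral_kernel_mul_mittagLeffler hα₀ hα₀ hb hx]
    simp only [add_sub_cancel, sub_self, Real.rpow_zero]
    push_cast
    field_simp
    ring
end

section
/- Let 0 < α < 2, let β ∈ ℝ, let μ be a real number with απ/2 < μ < min{π, πα}, let p ≥ 1 be an integer, let r > 0 and let θ ∈ ℝ with |θ| ≤ μ. Then, as t → ∞, E_{α,β}(r e^{iθ} t^α) − (1/α) (r e^{iθ} t^α)^{(1−β)/α} · exp((r e^{iθ} t^α)^{1/α}) + Σ_{k=1}^p (r e^{iθ} t^α)^{−k} / Γ(β − αk) is O(t^{−α(1+p)}), where complex powers are taken with the principal branch. -/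
open Filter Asymptotics Real

open MeasureTheory Set Topology

/-- The integrand `exp (e^w + c w)`, i.e. `e^ζ ζ^c` in the logarithmic coordinate `ζ = e^w`. -/
noncomputable def hexp (c : ℝ) (w : ℂ) : ℂ := Complex.exp (Complex.exp w + c * w)

lemma norm_hexp (c : ℝ) (w : ℂ) : ‖hexp c w‖ = exp (exp w.re * cos w.im + c * w.re) := by
  simp [hexp, Complex.norm_exp, Complex.exp_re]

lemma norm_hexp_line (c x y : ℝ) :
    ‖hexp c (x + (y : ℂ) * Complex.I)‖ = exp (exp x * cos y + c * x) := by
  simp [norm_hexp]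

lemma differentiable_hexp (c : ℝ) : Differentiable ℂ (hexp c) := by
  unfold hexp; fun_prop

lemma continuous_hexp (c : ℝ) : Continuous (hexp c) := (differentiable_hexp c).continuous

lemma hexp_add (c d : ℝ) (w : ℂ) : hexp (c + d) w = hexp c w * Complex.exp (d * w) := by
  simp only [hexp, ← Complex.exp_add]; congr 1; push_cast; ring

lemma hasDerivAt_hexp (c : ℝ) (w : ℂ) :
    HasDerivAt (hexp c) (hexp (c + 1) w + c * hexp c w) w := by
  have h := ((Complex.hasDerivAt_exp w).add ((hasDerivAt_id w).const_mul (c : ℂ))).cexp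
  refine h.congr_deriv ?_
  rw [hexp_add]
  simp [hexp]; ring

lemma tendsto_exp_neg_mul_exp_add_mul (κ c : ℝ) (hκ : 0 < κ) :
    Tendsto (fun x : ℝ => exp (-κ * exp x + c * x)) atTop (𝓝 0) := by
  have h := (tendsto_rpow_mul_exp_neg_mul_atTop_nhds_zero c κ hκ).comp tendsto_exp_atTop
  refine h.congr fun x => ?_
  simp only [Function.comp, ← Real.exp_mul, ← Real.exp_add]
  congr 1; ring

lemma integrableOn_exp_neg_mul_exp_add_mul (κ c a : ℝ) (hκ : 0 < κ) :
    IntegrableOn (fun x : ℝ => exp (-κ * exp x + c * x)) (Ioi a) := by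
  refine integrable_of_isBigO_exp_neg one_pos (by fun_prop) ?_
  have h := (tendsto_exp_neg_mul_exp_add_mul κ (c + 1) hκ).isBigO_one ℝ
  have h2 := h.mul (isBigO_refl (fun x : ℝ => exp (-1 * x)) atTop)
  refine (h2.congr_left fun x => ?_).congr_right fun x => by simp
  rw [← Real.exp_add]; congr 1; ring

lemma integrable_exp_neg_mul_exp_add_mul (κ c : ℝ) (hκ : 0 < κ) (hc : 0 < c) :
    Integrable (fun x : ℝ => exp (-κ * exp x + c * x)) := by
  rw [← integrableOn_univ, ← Iic_union_Ioi (a := (0 : ℝ))]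
  refine IntegrableOn.union ?_ (integrableOn_exp_neg_mul_exp_add_mul κ c 0 hκ)
  refine Integrable.mono' (integrableOn_exp_mul_Iic hc 0)
    (by fun_prop) (ae_of_all _ fun x => ?_)
  rw [Real.norm_eq_abs, abs_of_pos (exp_pos _)]
  gcongr
  nlinarith [exp_pos x]

lemma integrableOn_norm_hexp_Ioi (c a y : ℝ) (hy : cos y < 0) :
    IntegrableOn (fun x : ℝ => ‖hexp c (x + (y : ℂ) * Complex.I)‖) (Ioi a) := by
  simpa only [norm_hexp_line, mul_comm (exp _) (cos y), neg_neg] using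
    integrableOn_exp_neg_mul_exp_add_mul (-cos y) c a (by linarith)

lemma integrable_hexp (c y : ℝ) (hy : cos y < 0) (hc : 0 < c) :
    Integrable (fun x : ℝ => hexp c (x + (y : ℂ) * Complex.I)) := by
  have hm := (continuous_hexp c).comp (by fun_prop : Continuous fun x : ℝ => (x : ℂ) + y * Complex.I)
  refine (integrable_norm_iff hm.aestronglyMeasurable).1 ?_
  simpa only [Function.comp_apply, norm_hexp_line, mul_comm (exp _) (cos y), neg_neg] using
    integrable_exp_neg_mul_exp_add_mul (-cos y) c (by linarith) hc

lemma tendsto_exp_mul_atBot (c : ℝ) (hc : 0 < c) :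
    Tendsto (fun x : ℝ => exp (c * x)) atBot (𝓝 0) :=
  tendsto_exp_atBot.comp (tendsto_id.const_mul_atBot hc)

/-- The integral of `hexp c` over a horizontal line does not change when the line moves within a
strip where `cos` is negative. -/
lemma integral_hexp_eq_of_cos_neg (c κ y₁ y₂ : ℝ) (hc : 0 < c) (hκ : 0 < κ)
    (h : ∀ y ∈ uIcc y₁ y₂, cos y ≤ -κ) :
    ∫ x : ℝ, hexp c (x + (y₁ : ℂ) * Complex.I) = ∫ x : ℝ, hexp c (x + (y₂ : ℂ) * Complex.I) := by
  have hline : ∀ y ∈ uIcc y₁ y₂, Tendsto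
      (fun R : ℝ => ∫ x in (-R)..R, hexp c (x + (y : ℂ) * Complex.I)) atTop
      (𝓝 (∫ x : ℝ, hexp c (x + (y : ℂ) * Complex.I))) := fun y hy =>
    intervalIntegral_tendsto_integral (integrable_hexp c y (by linarith [h y hy]) hc)
      tendsto_neg_atTop_atBot tendsto_id
  have hvert : ∀ u : ℝ → ℝ, Tendsto (fun R => exp (-κ * exp (u R) + c * u R)) atTop (𝓝 0) →
      Tendsto (fun R : ℝ => ∫ y in y₁..y₂, hexp c (u R + (y : ℂ) * Complex.I)) atTop (𝓝 0) := by
    intro u hu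
    refine squeeze_zero_norm (a := fun R => exp (-κ * exp (u R) + c * u R) * |y₂ - y₁|) ?_
      (by simpa using hu.mul_const |y₂ - y₁|)
    intro R
    refine intervalIntegral.norm_integral_le_of_norm_le_const fun y hy => ?_
    rw [norm_hexp_line]
    have := h y (uIoc_subset_uIcc hy)
    exact exp_le_exp.2 (by nlinarith [exp_pos (u R)])
  have hr := hvert (fun R => R) (tendsto_exp_neg_mul_exp_add_mul κ c hκ)
  have hl := hvert (fun R => -R) <| by
    refine squeeze_zero (fun R => (exp_pos _).le) (fun R => ?_)
      ((tendsto_exp_mul_atBot c hc).comp tendsto_neg_atTop_atBot)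
    simp only [Function.comp]
    gcongr
    nlinarith [exp_pos (-R)]
  have key := (((hline y₁ left_mem_uIcc).sub (hline y₂ right_mem_uIcc)).add
    (hr.const_smul Complex.I)).sub (hl.const_smul Complex.I)
  have hzero := tendsto_nhds_unique key (tendsto_const_nhds.congr fun R => by
    have := Complex.integral_boundary_rect_eq_zero_of_differentiableOn (hexp c)
      ⟨-R, y₁⟩ ⟨R, y₂⟩ (differentiable_hexp c).differentiableOn
    exact this.symm)
  rw [smul_zero, add_zero, sub_zero] at hzero
  exact sub_eq_zero.1 hzero

lemma integral_exp_neg_exp_add_mul (c : ℝ) (hc : 0 < c) :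
    ∫ x : ℝ, Complex.exp (-Complex.exp x + c * x) = Complex.Gamma c := by
  rw [Complex.Gamma_eq_integral (by simpa using hc), Complex.GammaIntegral, ← Real.range_exp,
    ← image_univ, integral_image_eq_integral_abs_deriv_smul MeasurableSet.univ
      (fun x _ => (Real.hasDerivAt_exp x).hasDerivWithinAt) Real.exp_injective.injOn,
    setIntegral_univ]
  congr 1; ext x
  rw [abs_of_pos (exp_pos x), Complex.real_smul, Complex.cpow_def_of_ne_zero (by simp)]
  rw [← Complex.ofReal_log (exp_pos x).le, Real.log_exp]
  push_cast
  rw [← Complex.exp_add, ← Complex.exp_add]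
  congr 1; ring

lemma integral_hexp_pi (c : ℝ) (hc : 0 < c) :
    ∫ x : ℝ, hexp c (x + (π : ℂ) * Complex.I) =
      Complex.exp (π * c * Complex.I) * Complex.Gamma c := by
  rw [← integral_exp_neg_exp_add_mul c hc, ← integral_const_mul]
  congr 1; ext x
  rw [hexp, Complex.exp_add (x : ℂ), Complex.exp_pi_mul_I, ← Complex.exp_add]
  congr 1; ring

lemma integral_hexp_neg_pi (c : ℝ) (hc : 0 < c) :
    ∫ x : ℝ, hexp c (x + ((-π : ℝ) : ℂ) * Complex.I) =
      Complex.exp (-(π * c * Complex.I)) * Complex.Gamma c := by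
  rw [← integral_exp_neg_exp_add_mul c hc, ← integral_const_mul]
  congr 1; ext x
  rw [hexp, Complex.exp_add (x : ℂ), Complex.ofReal_neg, neg_mul, Complex.exp_neg,
    Complex.exp_pi_mul_I, ← Complex.exp_add]
  congr 1; norm_num; ring

lemma integral_hexp_sub_integral_hexp (c φ : ℝ) (hc : 0 < c) (hφ : π / 2 < φ) (hφ' : φ ≤ π) :
    (∫ x : ℝ, hexp c (x + (φ : ℂ) * Complex.I)) -
      ∫ x : ℝ, hexp c (x + ((-φ : ℝ) : ℂ) * Complex.I) =
      2 * π * Complex.I * (Complex.Gamma (1 - c : ℝ))⁻¹ := by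
  have hcos : ∀ y ∈ Icc φ π, cos y ≤ -(-cos φ) := fun y hy => by
    rw [neg_neg]; exact cos_le_cos_of_nonneg_of_le_pi (by linarith [pi_pos]) hy.2 hy.1
  have hneg : 0 < -cos φ := by
    have := cos_neg_of_pi_div_two_lt_of_lt hφ (by linarith [pi_pos]); linarith
  rw [integral_hexp_eq_of_cos_neg c _ φ π hc hneg (by rwa [uIcc_of_le hφ']),
    integral_hexp_eq_of_cos_neg c _ (-φ) (-π) hc hneg (fun y hy => by
      rw [uIcc_of_ge (by linarith)] at hy
      rw [← cos_neg]; exact hcos _ ⟨by linarith [hy.2], by linarith [hy.1]⟩),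
    integral_hexp_pi c hc, integral_hexp_neg_pi c hc, ← sub_mul]
  have hΓ : Complex.Gamma c ≠ 0 := Complex.Gamma_ne_zero_of_re_pos (by simpa using hc)
  have hsin : Complex.exp (π * c * Complex.I) - Complex.exp (-(π * c * Complex.I)) =
      2 * Complex.I * Complex.sin (π * c) := by
    rw [Complex.sin, neg_mul]; linear_combination (-(Complex.exp (-(π * c * Complex.I)) -
      Complex.exp (π * c * Complex.I))) * Complex.I_mul_I
  rw [hsin]
  have hrefl := Complex.Gamma_mul_Gamma_one_sub (c : ℂ)
  have hpi : (π : ℂ) ≠ 0 := by simp [pi_ne_zero]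
  push_cast
  by_cases hs : Complex.sin (π * c) = 0
  · rw [hs, div_zero] at hrefl
    have : Complex.Gamma (1 - c) = 0 := by simpa [hΓ] using hrefl
    simp [hs, this]
  · have h1 : Complex.Gamma (1 - c) ≠ 0 := by
      intro h0; rw [h0, mul_zero] at hrefl
      exact (div_ne_zero hpi hs) hrefl.symm
    rw [eq_div_iff hs] at hrefl
    rw [eq_mul_inv_iff_mul_eq₀ h1]
    linear_combination 2 * Complex.I * hrefl

/-- The integral of `f` over the boundary of the rectangle `[b, a] × [c, d]`, counterclockwise. -/
noncomputable def rectIntegral (b a c d : ℝ) (f : ℂ → ℂ) : ℂ :=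
  (∫ x in b..a, f (x + (c : ℂ) * Complex.I)) - (∫ x in b..a, f (x + (d : ℂ) * Complex.I)) +
    Complex.I • (∫ y in c..d, f (a + (y : ℂ) * Complex.I)) -
    Complex.I • ∫ y in c..d, f (b + (y : ℂ) * Complex.I)

lemma integral_horizontal_inv_sub {b a y : ℝ} {w₀ : ℂ} (hy : y ≠ w₀.im) :
    ∫ x in b..a, ((x : ℂ) + (y : ℂ) * Complex.I - w₀)⁻¹ =
      Complex.log (a + y * Complex.I - w₀) - Complex.log (b + y * Complex.I - w₀) := by
  have hs : ∀ x : ℝ, (x : ℂ) + y * Complex.I - w₀ ∈ Complex.slitPlane := fun x =>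
    Complex.mem_slitPlane_iff.2 (Or.inr (by simpa [sub_eq_zero] using hy))
  refine intervalIntegral.integral_eq_sub_of_hasDerivAt
    (f := fun x : ℝ => Complex.log (x + y * Complex.I - w₀)) (fun x _ => ?_) ?_
  · have h : HasDerivAt (fun x : ℝ => (x : ℂ) + y * Complex.I - w₀) 1 x :=
      (((hasDerivAt_id x).ofReal_comp).add_const _).sub_const _
    simpa using h.clog_real (hs x)
  · refine Continuous.intervalIntegrable ?_ _ _
    exact Continuous.inv₀ (by fun_prop) fun x => Complex.slitPlane_ne_zero (hs x)

lemma integral_vertical_inv_sub_of_re_lt {x c d : ℝ} {w₀ : ℂ} (hx : w₀.re < x) :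
    Complex.I • ∫ y in c..d, ((x : ℂ) + (y : ℂ) * Complex.I - w₀)⁻¹ =
      Complex.log (x + d * Complex.I - w₀) - Complex.log (x + c * Complex.I - w₀) := by
  have hs : ∀ y : ℝ, (x : ℂ) + y * Complex.I - w₀ ∈ Complex.slitPlane := fun y =>
    Complex.mem_slitPlane_iff.2 (Or.inl (by simpa using hx))
  rw [smul_eq_mul, ← intervalIntegral.integral_const_mul]
  refine intervalIntegral.integral_eq_sub_of_hasDerivAt
    (f := fun y : ℝ => Complex.log (x + y * Complex.I - w₀)) (fun y _ => ?_) ?_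
  · have h : HasDerivAt (fun y : ℝ => (x : ℂ) + y * Complex.I - w₀) Complex.I y := by
      simpa using ((((hasDerivAt_id y).ofReal_comp).mul_const Complex.I).const_add (x : ℂ)).sub_const w₀
    simpa [div_eq_mul_inv] using h.clog_real (hs y)
  · refine Continuous.intervalIntegrable ?_ _ _
    exact continuous_const.mul
      (Continuous.inv₀ (by fun_prop) fun y => Complex.slitPlane_ne_zero (hs y))

lemma integral_vertical_inv_sub_of_lt_re {x c d : ℝ} {w₀ : ℂ} (hx : x < w₀.re) :
    Complex.I • ∫ y in c..d, ((x : ℂ) + (y : ℂ) * Complex.I - w₀)⁻¹ =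
      Complex.log (-(x + d * Complex.I - w₀)) - Complex.log (-(x + c * Complex.I - w₀)) := by
  have hs : ∀ y : ℝ, -((x : ℂ) + y * Complex.I - w₀) ∈ Complex.slitPlane := fun y =>
    Complex.mem_slitPlane_iff.2 (Or.inl (by simpa using hx))
  rw [smul_eq_mul, ← intervalIntegral.integral_const_mul]
  refine intervalIntegral.integral_eq_sub_of_hasDerivAt
    (f := fun y : ℝ => Complex.log (-(x + y * Complex.I - w₀))) (fun y _ => ?_) ?_
  · have h : HasDerivAt (fun y : ℝ => -((x : ℂ) + y * Complex.I - w₀)) (-Complex.I) y := by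
      refine HasDerivAt.fun_neg ?_
      simpa using ((((hasDerivAt_id y).ofReal_comp).mul_const Complex.I).const_add (x : ℂ)).sub_const w₀
    exact (h.clog_real (hs y)).congr_deriv (by rw [neg_div_neg_eq, div_eq_mul_inv])
  · refine Continuous.intervalIntegrable ?_ _ _
    exact continuous_const.mul
      (Continuous.inv₀ (by fun_prop) fun y => neg_ne_zero.1 (Complex.slitPlane_ne_zero (hs y)))

lemma log_sub_log_neg_of_im_pos {z : ℂ} (hz : 0 < z.im) :
    Complex.log z - Complex.log (-z) = π * Complex.I := by
  simp only [Complex.log, Complex.arg_neg_eq_arg_sub_pi_of_im_pos hz, norm_neg]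
  push_cast; ring

lemma rectIntegral_inv_sub {b a c d : ℝ} {w₀ : ℂ} (hb : b < w₀.re) (ha : w₀.re < a)
    (hc : c < w₀.im) (hd : w₀.im < d) :
    rectIntegral b a c d (fun w => (w - w₀)⁻¹) = 2 * π * Complex.I := by
  rw [rectIntegral, integral_horizontal_inv_sub hc.ne, integral_horizontal_inv_sub hd.ne',
    integral_vertical_inv_sub_of_re_lt ha, integral_vertical_inv_sub_of_lt_re hb]
  have h1 := log_sub_log_neg_of_im_pos (z := b + d * Complex.I - w₀) (by simpa using hd)
  have h2 := log_sub_log_neg_of_im_pos (z := -(b + c * Complex.I - w₀)) (by simpa using hc)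
  rw [neg_neg] at h2
  linear_combination h1 + h2

lemma rectIntegral_add {b a c d : ℝ} {f g : ℂ → ℂ} {s : Set ℂ}
    (hs : ∀ x y : ℝ, (x ∈ uIcc b a ∧ (y = c ∨ y = d)) ∨ ((x = a ∨ x = b) ∧ y ∈ uIcc c d) →
      (x : ℂ) + y * Complex.I ∈ s)
    (hf : ContinuousOn f s) (hg : ContinuousOn g s) :
    rectIntegral b a c d (fun w => f w + g w) =
      rectIntegral b a c d f + rectIntegral b a c d g := by
  have hh : ∀ h : ℂ → ℂ, ContinuousOn h s → ∀ y : ℝ, (y = c ∨ y = d) →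
      IntervalIntegrable (fun x : ℝ => h (x + (y : ℂ) * Complex.I)) volume b a :=
    fun h hh y hy => (hh.comp (by fun_prop) fun x hx => hs x y (Or.inl ⟨hx, hy⟩)).intervalIntegrable
  have hv : ∀ h : ℂ → ℂ, ContinuousOn h s → ∀ x : ℝ, (x = a ∨ x = b) →
      IntervalIntegrable (fun y : ℝ => h (x + (y : ℂ) * Complex.I)) volume c d :=
    fun h hh x hx => (hh.comp (by fun_prop) fun y hy => hs x y (Or.inr ⟨hx, hy⟩)).intervalIntegrable
  simp only [rectIntegral]
  rw [intervalIntegral.integral_add (hh f hf c (by simp)) (hh g hg c (by simp)),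
    intervalIntegral.integral_add (hh f hf d (by simp)) (hh g hg d (by simp)),
    intervalIntegral.integral_add (hv f hf a (by simp)) (hv g hg a (by simp)),
    intervalIntegral.integral_add (hv f hf b (by simp)) (hv g hg b (by simp))]
  simp only [smul_eq_mul]
  ring

lemma rectIntegral_congr {b a c d : ℝ} {f g : ℂ → ℂ}
    (h : ∀ x y : ℝ, (x ∈ uIcc b a ∧ (y = c ∨ y = d)) ∨ ((x = a ∨ x = b) ∧ y ∈ uIcc c d) →
      f (x + y * Complex.I) = g (x + y * Complex.I)) :
    rectIntegral b a c d f = rectIntegral b a c d g := by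
  simp only [rectIntegral]
  congr 1
  · congr 1
    · congr 1 <;> exact intervalIntegral.integral_congr fun x hx => h x _ (Or.inl ⟨hx, by simp⟩)
    · congr 1; exact intervalIntegral.integral_congr fun y hy => h _ y (Or.inr ⟨by simp, hy⟩)
  · congr 1; exact intervalIntegral.integral_congr fun y hy => h _ y (Or.inr ⟨by simp, hy⟩)

lemma rectIntegral_eq_zero {b a c d : ℝ} {f : ℂ → ℂ}
    (hf : DifferentiableOn ℂ f (uIcc b a ×ℂ uIcc c d)) : rectIntegral b a c d f = 0 :=
  Complex.integral_boundary_rect_eq_zero_of_differentiableOn f ⟨b, c⟩ ⟨a, d⟩ hf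

/-- Cauchy's integral formula for a rectangle. -/
lemma rectIntegral_div_sub {b a c d : ℝ} {w₀ : ℂ} (hb : b < w₀.re) (ha : w₀.re < a)
    (hc : c < w₀.im) (hd : w₀.im < d) {f : ℂ → ℂ}
    (hf : DifferentiableOn ℂ f (uIcc b a ×ℂ uIcc c d)) :
    rectIntegral b a c d (fun w => f w / (w - w₀)) = 2 * π * Complex.I * f w₀ := by
  have hba := hb.trans ha
  have hcd := hc.trans hd
  have hnhds : uIcc b a ×ℂ uIcc c d ∈ 𝓝 w₀ := by
    rw [uIcc_of_le hba.le, uIcc_of_le hcd.le]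
    exact Filter.inter_mem (Complex.continuous_re.continuousAt (Icc_mem_nhds hb ha))
      (Complex.continuous_im.continuousAt (Icc_mem_nhds hc hd))
  have hds : DifferentiableOn ℂ (dslope f w₀) (uIcc b a ×ℂ uIcc c d) :=
    (Complex.differentiableOn_dslope hnhds).2 hf
  set s : Set ℂ := (uIcc b a ×ℂ uIcc c d) \ {w₀} with hs_def
  have hs : ∀ x y : ℝ, (x ∈ uIcc b a ∧ (y = c ∨ y = d)) ∨ ((x = a ∨ x = b) ∧ y ∈ uIcc c d) →
      (x : ℂ) + y * Complex.I ∈ s := by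
    intro x y h
    refine ⟨?_, fun heq => ?_⟩
    · rw [Complex.mem_reProdIm]
      rcases h with ⟨h1, rfl | rfl⟩ | ⟨rfl | rfl, h2⟩ <;> simp_all
    · have hre : x = w₀.re := by simpa using congrArg Complex.re (mem_singleton_iff.1 heq)
      have him : y = w₀.im := by simpa using congrArg Complex.im (mem_singleton_iff.1 heq)
      rcases h with ⟨h1, h | h⟩ | ⟨h | h, h2⟩ <;> linarith
  have hinv : ContinuousOn (fun w => (w - w₀)⁻¹) s :=
    ContinuousOn.inv₀ (by fun_prop) fun w hw => sub_ne_zero.2 hw.2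
  have hdecomp : rectIntegral b a c d (fun w => f w / (w - w₀)) =
      rectIntegral b a c d (fun w => dslope f w₀ w + f w₀ * (w - w₀)⁻¹) := by
    refine rectIntegral_congr fun x y h => ?_
    have hne : (x : ℂ) + y * Complex.I ≠ w₀ := (hs x y h).2
    rw [dslope_of_ne _ hne, slope_def_field]
    field_simp [sub_ne_zero.2 hne]
    ring
  rw [hdecomp, rectIntegral_add hs (hds.continuousOn.mono sdiff_subset)
    (hinv.const_mul _ |>.congr fun _ _ => rfl), rectIntegral_eq_zero hds, zero_add]
  have := rectIntegral_inv_sub hb ha hc hd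
  rw [← this]
  simp only [rectIntegral, intervalIntegral.integral_const_mul, smul_eq_mul]
  ring

/-- The Hankel contour with half-angle `φ` and abscissa `a`, in logarithmic coordinates. -/
def hankelContour (φ a : ℝ) : Set ℂ :=
  {w | a ≤ w.re ∧ (w.im = φ ∨ w.im = -φ) ∨ w.re = a ∧ w.im ∈ Icc (-φ) φ}

/-- The integral of `F` over `hankelContour φ a`, from `∞ - iφ` to `∞ + iφ`. -/
noncomputable def hankelIntegral (φ a : ℝ) (F : ℂ → ℂ) : ℂ :=
  (∫ x in Ioi a, F (x + (φ : ℂ) * Complex.I)) -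
    (∫ x in Ioi a, F (x + ((-φ : ℝ) : ℂ) * Complex.I)) +
    Complex.I • ∫ y in (-φ)..φ, F (a + (y : ℂ) * Complex.I)

/-- Integrability of `F` on the three pieces of `hankelContour φ a`. -/
def HankelIntegrable (φ a : ℝ) (F : ℂ → ℂ) : Prop :=
  IntegrableOn (fun x : ℝ => F (x + (φ : ℂ) * Complex.I)) (Ioi a) ∧
    IntegrableOn (fun x : ℝ => F (x + ((-φ : ℝ) : ℂ) * Complex.I)) (Ioi a) ∧
    IntervalIntegrable (fun y : ℝ => F (a + (y : ℂ) * Complex.I)) volume (-φ) φ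

/-- The integral of `‖hexp c‖` with respect to arc length on `hankelContour φ a`. -/
noncomputable def hankelMass (φ a c : ℝ) : ℝ :=
  (∫ x in Ioi a, ‖hexp c (x + (φ : ℂ) * Complex.I)‖) +
    (∫ x in Ioi a, ‖hexp c (x + ((-φ : ℝ) : ℂ) * Complex.I)‖) +
    ∫ y in (-φ)..φ, ‖hexp c (a + (y : ℂ) * Complex.I)‖

lemma mem_hankelContour_upper {φ a x : ℝ} (hx : a ≤ x) :
    (x : ℂ) + (φ : ℂ) * Complex.I ∈ hankelContour φ a := by
  left; simpa using hx

lemma mem_hankelContour_lower {φ a x : ℝ} (hx : a ≤ x) :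
    (x : ℂ) + ((-φ : ℝ) : ℂ) * Complex.I ∈ hankelContour φ a := by
  left; simpa using hx

lemma mem_hankelContour_vertical {φ a y : ℝ} (hy : y ∈ Icc (-φ) φ) :
    (a : ℂ) + (y : ℂ) * Complex.I ∈ hankelContour φ a := by
  right; simpa using hy

lemma le_re_of_mem_hankelContour {φ a : ℝ} {w : ℂ} (hw : w ∈ hankelContour φ a) : a ≤ w.re := by
  rcases hw with h | h
  · exact h.1
  · exact h.1.ge

lemma HankelIntegrable.add {φ a : ℝ} {F G : ℂ → ℂ} (hF : HankelIntegrable φ a F)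
    (hG : HankelIntegrable φ a G) : HankelIntegrable φ a (fun w => F w + G w) :=
  ⟨hF.1.add hG.1, hF.2.1.add hG.2.1, hF.2.2.add hG.2.2⟩

lemma HankelIntegrable.const_mul {φ a : ℝ} {F : ℂ → ℂ} (hF : HankelIntegrable φ a F) (z : ℂ) :
    HankelIntegrable φ a (fun w => z * F w) :=
  ⟨hF.1.const_mul z, hF.2.1.const_mul z, hF.2.2.const_mul z⟩

lemma hankelIntegral_add {φ a : ℝ} {F G : ℂ → ℂ} (hF : HankelIntegrable φ a F)
    (hG : HankelIntegrable φ a G) :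
    hankelIntegral φ a (fun w => F w + G w) = hankelIntegral φ a F + hankelIntegral φ a G := by
  simp only [hankelIntegral]
  rw [integral_add hF.1 hG.1, integral_add hF.2.1 hG.2.1,
    intervalIntegral.integral_add hF.2.2 hG.2.2]
  simp only [smul_eq_mul]; ring

lemma hankelIntegral_const_mul (φ a : ℝ) (F : ℂ → ℂ) (z : ℂ) :
    hankelIntegral φ a (fun w => z * F w) = z * hankelIntegral φ a F := by
  simp only [hankelIntegral, integral_const_mul, intervalIntegral.integral_const_mul, smul_eq_mul]
  ring

lemma hankelIntegral_congr {φ a : ℝ} (hφ : 0 ≤ φ) {F G : ℂ → ℂ}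
    (h : ∀ w ∈ hankelContour φ a, F w = G w) : hankelIntegral φ a F = hankelIntegral φ a G := by
  simp only [hankelIntegral]
  congr 1
  · congr 1
    · exact setIntegral_congr_fun measurableSet_Ioi fun x hx =>
        h _ (mem_hankelContour_upper (le_of_lt hx))
    · exact setIntegral_congr_fun measurableSet_Ioi fun x hx =>
        h _ (mem_hankelContour_lower (le_of_lt hx))
  · congr 1
    refine intervalIntegral.integral_congr fun y hy => h _ (mem_hankelContour_vertical ?_)
    rwa [uIcc_of_le (by linarith)] at hy

lemma HankelIntegrable.of_norm_le {φ a c B : ℝ} (hφ : 0 ≤ φ) (hcos : cos φ < 0) {F : ℂ → ℂ}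
    (hF : ContinuousOn F (hankelContour φ a))
    (hB : ∀ w ∈ hankelContour φ a, ‖F w‖ ≤ B * ‖hexp c w‖) : HankelIntegrable φ a F := by
  refine ⟨?_, ?_, ?_⟩
  · refine Integrable.mono' ((integrableOn_norm_hexp_Ioi c a φ hcos).const_mul B) ?_ ?_
    · refine ContinuousOn.aestronglyMeasurable ?_ measurableSet_Ioi
      exact hF.comp (by fun_prop) fun x hx => mem_hankelContour_upper (le_of_lt hx)
    · exact (ae_restrict_mem measurableSet_Ioi).mono fun x hx =>
        hB _ (mem_hankelContour_upper (le_of_lt hx))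
  · refine Integrable.mono'
      ((integrableOn_norm_hexp_Ioi c a (-φ) (by rwa [cos_neg])).const_mul B) ?_ ?_
    · refine ContinuousOn.aestronglyMeasurable ?_ measurableSet_Ioi
      exact hF.comp (by fun_prop) fun x hx => mem_hankelContour_lower (le_of_lt hx)
    · exact (ae_restrict_mem measurableSet_Ioi).mono fun x hx =>
        hB _ (mem_hankelContour_lower (le_of_lt hx))
  · refine ContinuousOn.intervalIntegrable ?_
    rw [uIcc_of_le (by linarith)]
    exact hF.comp (by fun_prop) fun y hy => mem_hankelContour_vertical hy

lemma norm_hankelIntegral_le {φ a c B : ℝ} (hφ : 0 ≤ φ) (hcos : cos φ < 0) {F : ℂ → ℂ}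
    (hB : ∀ w ∈ hankelContour φ a, ‖F w‖ ≤ B * ‖hexp c w‖) :
    ‖hankelIntegral φ a F‖ ≤ B * hankelMass φ a c := by
  have h1 : ‖∫ x in Ioi a, F (x + (φ : ℂ) * Complex.I)‖ ≤
      B * ∫ x in Ioi a, ‖hexp c (x + (φ : ℂ) * Complex.I)‖ := by
    rw [← integral_const_mul]
    exact norm_integral_le_of_norm_le ((integrableOn_norm_hexp_Ioi c a φ hcos).const_mul B)
      ((ae_restrict_mem measurableSet_Ioi).mono fun x hx =>
        hB _ (mem_hankelContour_upper (le_of_lt hx)))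
  have h2 : ‖∫ x in Ioi a, F (x + ((-φ : ℝ) : ℂ) * Complex.I)‖ ≤
      B * ∫ x in Ioi a, ‖hexp c (x + ((-φ : ℝ) : ℂ) * Complex.I)‖ := by
    rw [← integral_const_mul]
    exact norm_integral_le_of_norm_le
      ((integrableOn_norm_hexp_Ioi c a (-φ) (by rwa [cos_neg])).const_mul B)
      ((ae_restrict_mem measurableSet_Ioi).mono fun x hx =>
        hB _ (mem_hankelContour_lower (le_of_lt hx)))
  have h3 : ‖Complex.I • ∫ y in (-φ)..φ, F (a + (y : ℂ) * Complex.I)‖ ≤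
      B * ∫ y in (-φ)..φ, ‖hexp c (a + (y : ℂ) * Complex.I)‖ := by
    rw [norm_smul, Complex.norm_I, one_mul, ← intervalIntegral.integral_const_mul]
    refine intervalIntegral.norm_integral_le_of_norm_le (by linarith)
      (ae_of_all _ fun y hy => hB _ (mem_hankelContour_vertical (Ioc_subset_Icc_self hy))) ?_
    refine Continuous.intervalIntegrable ?_ _ _
    exact continuous_const.mul ((continuous_hexp c).comp (by fun_prop)).norm
  calc ‖hankelIntegral φ a F‖ ≤ _ := norm_add_le _ _
    _ ≤ _ := add_le_add_left (norm_sub_le _ _) _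
    _ ≤ B * hankelMass φ a c := by rw [hankelMass]; linarith

lemma hankelIntegrable_hexp {φ : ℝ} (hφ : 0 ≤ φ) (hcos : cos φ < 0) (a c : ℝ) :
    HankelIntegrable φ a (hexp c) :=
  HankelIntegrable.of_norm_le (c := c) (B := 1) hφ hcos (continuous_hexp c).continuousOn
    (fun w _ => by rw [one_mul])

lemma hankelIntegral_sub_hankelIntegral {φ a b : ℝ} {F : ℂ → ℂ} (ha : HankelIntegrable φ a F)
    (hb : HankelIntegrable φ b F) :
    hankelIntegral φ a F - hankelIntegral φ b F = rectIntegral b a (-φ) φ F := by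
  have h1 := intervalIntegral.integral_interval_add_Ioi hb.1 ha.1
  have h2 := intervalIntegral.integral_interval_add_Ioi hb.2.1 ha.2.1
  simp only [hankelIntegral, rectIntegral, ← h1, ← h2]
  ring

lemma hankelIntegral_hexp_eq {φ : ℝ} (hφ : 0 ≤ φ) (hcos : cos φ < 0) (a b c : ℝ) :
    hankelIntegral φ a (hexp c) = hankelIntegral φ b (hexp c) := by
  rw [← sub_eq_zero, hankelIntegral_sub_hankelIntegral (hankelIntegrable_hexp hφ hcos a c)
    (hankelIntegrable_hexp hφ hcos b c)]
  exact rectIntegral_eq_zero (differentiable_hexp c).differentiableOn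

lemma hankelIntegral_hexp_of_pos {φ : ℝ} (hφ : π / 2 < φ) (hφ' : φ ≤ π) (a c : ℝ) (hc : 0 < c) :
    hankelIntegral φ a (hexp c) = 2 * π * Complex.I * (Complex.Gamma (1 - c : ℝ))⁻¹ := by
  have hφ0 : 0 ≤ φ := by linarith [pi_pos]
  have hcos : cos φ < 0 := cos_neg_of_pi_div_two_lt_of_lt hφ (by linarith [pi_pos])
  rw [← integral_hexp_sub_integral_hexp c φ hc hφ hφ']
  have hline : ∀ y : ℝ, cos y < 0 → Tendsto (fun b : ℝ => ∫ x in Ioi b,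
      hexp c (x + (y : ℂ) * Complex.I)) atBot (𝓝 (∫ x : ℝ, hexp c (x + (y : ℂ) * Complex.I))) :=
    fun y hy => (aecover_Ioi tendsto_id).integral_tendsto_of_countably_generated
      (integrable_hexp c y hy hc)
  have hvert : Tendsto (fun b : ℝ => ∫ y in (-φ)..φ, hexp c (b + (y : ℂ) * Complex.I)) atBot
      (𝓝 0) := by
    refine squeeze_zero_norm (a := fun b => exp (exp b + c * b) * |φ - -φ|) (fun b => ?_) ?_
    · refine intervalIntegral.norm_integral_le_of_norm_le_const fun y _ => ?_
      rw [norm_hexp_line]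
      exact exp_le_exp.2 (by nlinarith [exp_pos b, cos_le_one y])
    · have := ((tendsto_exp_atBot.rexp).mul (tendsto_exp_mul_atBot c hc)).mul_const |φ - -φ|
      simpa only [Real.exp_add, mul_zero, zero_mul] using this
  have key := ((hline φ hcos).sub (hline (-φ) (by rwa [cos_neg]))).add (hvert.const_smul Complex.I)
  rw [smul_zero, add_zero] at key
  exact tendsto_nhds_unique (tendsto_const_nhds.congr fun b => hankelIntegral_hexp_eq hφ0 hcos a b c)
    key

lemma continuousAt_hankelIntegral_hexp {φ : ℝ} (hcos : cos φ < 0) (a : ℝ) :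
    ContinuousAt (fun c => hankelIntegral φ a (hexp c)) 0 := by
  have hcont : Continuous fun q : ℝ × ℂ => hexp q.1 q.2 := by unfold hexp; fun_prop
  have hbound : ∀ c ∈ Icc (-1 : ℝ) 1, ∀ w, ‖hexp c w‖ ≤ ‖hexp (-1) w‖ + ‖hexp 1 w‖ := by
    intro c hc w
    simp only [norm_hexp]
    rcases le_total 0 w.re with h | h
    · refine le_add_of_nonneg_of_le (exp_pos _).le (exp_le_exp.2 ?_)
      nlinarith [hc.2]
    · refine le_add_of_le_of_nonneg (exp_le_exp.2 ?_) (exp_pos _).le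
      nlinarith [hc.1]
  have hmem : ∀ᶠ c : ℝ in 𝓝 0, c ∈ Icc (-1 : ℝ) 1 := Icc_mem_nhds (by norm_num) (by norm_num)
  have hline : ∀ y : ℝ, cos y < 0 → ContinuousAt (fun c : ℝ => ∫ x in Ioi a,
      hexp c (x + (y : ℂ) * Complex.I)) 0 := by
    intro y hy
    refine continuousAt_of_dominated (bound := fun x => ‖hexp (-1) (x + (y : ℂ) * Complex.I)‖ +
      ‖hexp 1 (x + (y : ℂ) * Complex.I)‖) ?_ ?_ ?_ ?_
    · exact Eventually.of_forall fun c =>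
        ((continuous_hexp c).comp (by fun_prop)).aestronglyMeasurable
    · filter_upwards [hmem] with c hc using ae_of_all _ fun x => hbound c hc _
    · exact (integrableOn_norm_hexp_Ioi _ a y hy).add (integrableOn_norm_hexp_Ioi _ a y hy)
    · exact ae_of_all _ fun x => (hcont.comp (by fun_prop :
        Continuous fun c : ℝ => (c, (x : ℂ) + y * Complex.I))).continuousAt
  have hvert : Continuous fun c : ℝ => ∫ y in (-φ)..φ, hexp c (a + (y : ℂ) * Complex.I) :=
    intervalIntegral.continuous_parametric_intervalIntegral_of_continuous
      (f := fun (c y : ℝ) => hexp c (a + (y : ℂ) * Complex.I)) (hcont.comp (by fun_prop :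
        Continuous fun q : ℝ × ℝ => (q.1, (a : ℂ) + q.2 * Complex.I))) continuous_const
  exact ((hline φ hcos).sub (hline (-φ) (by rwa [cos_neg]))).add
    (hvert.continuousAt.const_mul Complex.I)

lemma hankelIntegral_deriv_hexp {φ : ℝ} (hφ : 0 ≤ φ) (hcos : cos φ < 0) (a c : ℝ) :
    hankelIntegral φ a (fun w => hexp (c + 1) w + c * hexp c w) = 0 := by
  have hadd_int := (hankelIntegrable_hexp hφ hcos a (c + 1)).add
    ((hankelIntegrable_hexp hφ hcos a c).const_mul c)
  have hderiv : ∀ x y : ℝ, HasDerivAt (fun x : ℝ => hexp c (x + (y : ℂ) * Complex.I))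
      (hexp (c + 1) (x + (y : ℂ) * Complex.I) + c * hexp c (x + (y : ℂ) * Complex.I)) x := by
    intro x y
    have := (hasDerivAt_hexp c (x + (y : ℂ) * Complex.I)).comp x
      (((hasDerivAt_id x).ofReal_comp).add_const ((y : ℂ) * Complex.I))
    simpa [Function.comp_def] using this
  have hlim : ∀ y : ℝ, cos y < 0 →
      Tendsto (fun x : ℝ => hexp c (x + (y : ℂ) * Complex.I)) atTop (𝓝 0) := by
    intro y hy
    rw [tendsto_zero_iff_norm_tendsto_zero]
    simpa only [norm_hexp_line, mul_comm (exp _) (cos y), neg_neg] using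
      tendsto_exp_neg_mul_exp_add_mul (-cos y) c (by linarith)
  have hline : ∀ y : ℝ, cos y < 0 → IntegrableOn (fun x : ℝ =>
      hexp (c + 1) (x + (y : ℂ) * Complex.I) + c * hexp c (x + (y : ℂ) * Complex.I)) (Ioi a) →
      ∫ x in Ioi a, (hexp (c + 1) (x + (y : ℂ) * Complex.I) +
        c * hexp c (x + (y : ℂ) * Complex.I)) = 0 - hexp c (a + (y : ℂ) * Complex.I) :=
    fun y hy hi => integral_Ioi_of_hasDerivAt_of_tendsto
      (hderiv a y).continuousAt.continuousWithinAt (fun x _ => hderiv x y) hi (hlim y hy)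
  have hvert : Complex.I • ∫ y in (-φ)..φ, (hexp (c + 1) (a + (y : ℂ) * Complex.I) +
      c * hexp c (a + (y : ℂ) * Complex.I)) =
      hexp c (a + (φ : ℂ) * Complex.I) - hexp c (a + ((-φ : ℝ) : ℂ) * Complex.I) := by
    rw [smul_eq_mul, ← intervalIntegral.integral_const_mul]
    refine intervalIntegral.integral_eq_sub_of_hasDerivAt
      (f := fun y : ℝ => hexp c (a + (y : ℂ) * Complex.I)) (fun y _ => ?_)
      (hadd_int.2.2.const_mul Complex.I)
    have := (hasDerivAt_hexp c (a + (y : ℂ) * Complex.I)).comp y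
      ((((hasDerivAt_id y).ofReal_comp).mul_const Complex.I).const_add (a : ℂ))
    simpa [Function.comp_def, mul_comm] using this
  rw [hankelIntegral, hline φ hcos hadd_int.1, hline (-φ) (by rwa [cos_neg]) hadd_int.2.1, hvert]
  ring

/-- Hankel's integral representation of the reciprocal Gamma function. -/
lemma hankelIntegral_hexp {φ : ℝ} (hφ : π / 2 < φ) (hφ' : φ ≤ π) (a c : ℝ) :
    hankelIntegral φ a (hexp c) = 2 * π * Complex.I * (Complex.Gamma (1 - c : ℝ))⁻¹ := by
  have hφ0 : 0 ≤ φ := by linarith [pi_pos]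
  have hcos : cos φ < 0 := cos_neg_of_pi_div_two_lt_of_lt hφ (by linarith [pi_pos])
  have hzero : hankelIntegral φ a (hexp 0) =
      2 * π * Complex.I * (Complex.Gamma (1 - (0 : ℝ) : ℝ))⁻¹ := by
    have hR : Continuous fun c : ℝ => 2 * π * Complex.I * (Complex.Gamma (1 - c : ℝ))⁻¹ :=
      continuous_const.mul (Complex.differentiable_one_div_Gamma.continuous.comp (by fun_prop))
    refine tendsto_nhds_unique (l := 𝓝[>] (0 : ℝ))
      ((continuousAt_hankelIntegral_hexp hcos a).tendsto.mono_left nhdsWithin_le_nhds) ?_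
    refine ((hR.tendsto 0).mono_left nhdsWithin_le_nhds).congr' ?_
    filter_upwards [self_mem_nhdsWithin] with c hc
    exact (hankelIntegral_hexp_of_pos hφ hφ' a c hc).symm
  suffices h : ∀ n : ℕ, ∀ c : ℝ, -(n : ℝ) < c →
      hankelIntegral φ a (hexp c) = 2 * π * Complex.I * (Complex.Gamma (1 - c : ℝ))⁻¹ by
    obtain ⟨n, hn⟩ := exists_nat_gt (-c)
    exact h n c (by linarith)
  intro n
  induction n with
  | zero => exact fun c hc => hankelIntegral_hexp_of_pos hφ hφ' a c (by simpa using hc)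
  | succ n ih =>
    intro c hc
    rcases eq_or_ne c 0 with rfl | hc0
    · exact hzero
    have h1 := hankelIntegral_deriv_hexp hφ0 hcos a c
    rw [hankelIntegral_add (hankelIntegrable_hexp hφ0 hcos a (c + 1))
      ((hankelIntegrable_hexp hφ0 hcos a c).const_mul c), hankelIntegral_const_mul,
      ih (c + 1) (by push_cast at hc; linarith)] at h1
    have h2 := Complex.one_div_Gamma_eq_self_mul_one_div_Gamma_add_one (-c : ℂ)
    have hc0' : (c : ℂ) ≠ 0 := by exact_mod_cast hc0
    have e1 : ((1 - (c + 1) : ℝ) : ℂ) = -c := by push_cast; ring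
    have e2 : ((1 - c : ℝ) : ℂ) = -c + 1 := by push_cast; ring
    rw [e1, h2] at h1
    rw [e2]
    refine mul_left_cancel₀ hc0' ?_
    linear_combination h1

/-- The integrand `e^ζ ζ^c / (ζ^α - z)` in the logarithmic coordinate `ζ = e^w`. -/
noncomputable def mlKernel (α c : ℝ) (z w : ℂ) : ℂ := hexp c w / (Complex.exp (α * w) - z)

lemma norm_exp_ofReal_mul (α : ℝ) (w : ℂ) : ‖Complex.exp (α * w)‖ = exp (α * w.re) := by
  simp [Complex.norm_exp]

lemma norm_hexp_sub_le {a c d : ℝ} (hd : 0 ≤ d) {w : ℂ} (hw : a ≤ w.re) :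
    ‖hexp (c - d) w‖ ≤ exp (-(d * a)) * ‖hexp c w‖ := by
  rw [norm_hexp, norm_hexp, ← Real.exp_add]
  exact exp_le_exp.2 (by nlinarith)

section Kernel

variable {α φ a δ : ℝ} {z : ℂ}

lemma norm_mlKernel_le (hδ : 0 < δ)
    (hq : ∀ w ∈ hankelContour φ a, δ ≤ ‖Complex.exp (α * w) - z‖) (c : ℝ) {w : ℂ}
    (hw : w ∈ hankelContour φ a) : ‖mlKernel α c z w‖ ≤ δ⁻¹ * ‖hexp c w‖ := by
  rw [mlKernel, norm_div, div_eq_inv_mul]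
  gcongr
  exact hq w hw

lemma hankelIntegrable_mlKernel (hφ : 0 ≤ φ) (hcos : cos φ < 0) (hδ : 0 < δ)
    (hq : ∀ w ∈ hankelContour φ a, δ ≤ ‖Complex.exp (α * w) - z‖) (c : ℝ) :
    HankelIntegrable φ a (mlKernel α c z) := by
  refine HankelIntegrable.of_norm_le hφ hcos ?_ fun w hw => norm_mlKernel_le hδ hq c hw
  refine (continuous_hexp c).continuousOn.div (by fun_prop) fun w hw h => ?_
  have := hq w hw
  rw [h, norm_zero] at this
  linarith

lemma hankelIntegral_mlKernel_add (hφ : 0 ≤ φ) (hcos : cos φ < 0) (hδ : 0 < δ)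
    (hq : ∀ w ∈ hankelContour φ a, δ ≤ ‖Complex.exp (α * w) - z‖) (c : ℝ) :
    hankelIntegral φ a (mlKernel α (c + α) z) =
      hankelIntegral φ a (hexp c) + z * hankelIntegral φ a (mlKernel α c z) := by
  rw [← hankelIntegral_const_mul, ← hankelIntegral_add (hankelIntegrable_hexp hφ hcos a c)
    ((hankelIntegrable_mlKernel hφ hcos hδ hq c).const_mul z)]
  refine hankelIntegral_congr hφ fun w hw => ?_
  have hne : Complex.exp (α * w) - z ≠ 0 := fun h => by
    have := hq w hw
    rw [h, norm_zero] at this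
    linarith
  rw [mlKernel, mlKernel, hexp_add]
  field_simp
  ring

lemma hankelIntegral_mlKernel_eq_sum_add (hφ : 0 ≤ φ) (hcos : cos φ < 0) (hδ : 0 < δ)
    (hq : ∀ w ∈ hankelContour φ a, δ ≤ ‖Complex.exp (α * w) - z‖) (c : ℝ) (n : ℕ) :
    hankelIntegral φ a (mlKernel α (c + α) z) =
      ∑ k ∈ Finset.range n, z ^ k * hankelIntegral φ a (hexp (c - k * α)) +
        z ^ n * hankelIntegral φ a (mlKernel α (c + α - n * α) z) := by
  induction n with
  | zero => simp
  | succ n ih =>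
    have h := hankelIntegral_mlKernel_add hφ hcos hδ hq (c - n * α)
    have e : c + α - ((n + 1 : ℕ) : ℝ) * α = c - n * α := by push_cast; ring
    rw [ih, Finset.sum_range_succ, e, show c + α - n * α = c - n * α + α by ring, h]
    ring

lemma hankelIntegral_mlKernel_eq_neg_sum_add (hφ : 0 ≤ φ) (hcos : cos φ < 0) (hδ : 0 < δ)
    (hq : ∀ w ∈ hankelContour φ a, δ ≤ ‖Complex.exp (α * w) - z‖) (hz : z ≠ 0) (c : ℝ) (p : ℕ) :
    hankelIntegral φ a (mlKernel α (c + α) z) =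
      -∑ k ∈ Finset.Icc 1 p, z ^ (-(k : ℤ)) * hankelIntegral φ a (hexp (c + k * α)) +
        z ^ (-(p : ℤ)) * hankelIntegral φ a (mlKernel α (c + (p + 1) * α) z) := by
  induction p with
  | zero => simp
  | succ p ih =>
    have h := hankelIntegral_mlKernel_add hφ hcos hδ hq (c + (p + 1) * α)
    rw [ih, Finset.sum_Icc_succ_top (by omega)]
    push_cast
    rw [show c + ((p : ℝ) + 1 + 1) * α = c + (p + 1) * α + α by ring, h, neg_add]
    have hzp : z ^ (-(p : ℤ)) = z ^ (-((p : ℤ) + 1)) * z := by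
      rw [← zpow_add_one₀ hz]; congr 1; ring
    rw [hzp]
    ring

lemma hasSum_hankelIntegral_mlKernel (hα : 0 < α) (hφ : 0 ≤ φ) (hcos : cos φ < 0)
    (hz : ‖z‖ < exp (α * a)) (c : ℝ) :
    HasSum (fun k : ℕ => z ^ k * hankelIntegral φ a (hexp (c - k * α)))
      (hankelIntegral φ a (mlKernel α (c + α) z)) := by
  have hδ : 0 < exp (α * a) - ‖z‖ := sub_pos.2 hz
  have hq : ∀ w ∈ hankelContour φ a, exp (α * a) - ‖z‖ ≤ ‖Complex.exp (α * w) - z‖ := by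
    intro w hw
    have h1 := norm_sub_norm_le (Complex.exp (α * w)) z
    rw [norm_exp_ofReal_mul] at h1
    have h2 := exp_le_exp.2 (mul_le_mul_of_nonneg_left (le_re_of_mem_hankelContour hw) hα.le)
    linarith
  set ρ : ℝ := ‖z‖ * exp (-(α * a)) with hρ
  have hρ0 : 0 ≤ ρ := by positivity
  have hρ1 : ρ < 1 := by
    rw [hρ, Real.exp_neg, ← div_eq_mul_inv, div_lt_one (exp_pos _)]
    exact hz
  have hpow : ∀ n : ℕ, ‖z‖ ^ n * exp (-(n * α * a)) = ρ ^ n := by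
    intro n
    rw [hρ, mul_pow, ← Real.exp_nat_mul]
    congr 2; ring
  have hnα : ∀ n : ℕ, 0 ≤ (n : ℝ) * α := fun n => by positivity
  have hsum : Summable (fun k : ℕ => z ^ k * hankelIntegral φ a (hexp (c - k * α))) := by
    refine Summable.of_norm_bounded
      ((summable_geometric_of_lt_one hρ0 hρ1).mul_right (hankelMass φ a c)) fun k => ?_
    rw [norm_mul, norm_pow, ← hpow, mul_assoc]
    gcongr
    exact norm_hankelIntegral_le hφ hcos fun w hw =>
      norm_hexp_sub_le (hnα k) (le_re_of_mem_hankelContour hw)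
  refine (hsum.hasSum_iff_tendsto_nat).2 ?_
  have hrem : Tendsto (fun n : ℕ => z ^ n * hankelIntegral φ a (mlKernel α (c + α - n * α) z))
      atTop (𝓝 0) := by
    refine squeeze_zero_norm
      (a := fun n : ℕ => ρ ^ n * ((exp (α * a) - ‖z‖)⁻¹ * hankelMass φ a (c + α))) (fun n => ?_) ?_
    · rw [norm_mul, norm_pow, ← hpow, mul_assoc]
      gcongr
      rw [← mul_assoc]
      refine norm_hankelIntegral_le hφ hcos fun w hw => ?_
      refine (norm_mlKernel_le hδ hq _ hw).trans ?_
      rw [mul_comm (exp (-(n * α * a))), mul_assoc]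
      gcongr
      exact norm_hexp_sub_le (hnα n) (le_re_of_mem_hankelContour hw)
    · simpa using (tendsto_pow_atTop_nhds_zero_of_lt_one hρ0 hρ1).mul_const
        ((exp (α * a) - ‖z‖)⁻¹ * hankelMass φ a (c + α))
  have := (tendsto_const_nhds (x := hankelIntegral φ a (mlKernel α (c + α) z))).sub hrem
  rw [sub_zero] at this
  refine this.congr fun n => ?_
  rw [hankelIntegral_mlKernel_eq_sum_add hφ hcos hδ hq c n]
  ring

end Kernel

lemma hankelIntegral_mlKernel_eq_mittagLeffler {α φ a : ℝ} {z : ℂ} (hα : 0 < α) (hφ : π / 2 < φ)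
    (hφ' : φ ≤ π) (hz : ‖z‖ < exp (α * a)) (β : ℝ) :
    hankelIntegral φ a (mlKernel α (1 - β + α) z) = 2 * π * Complex.I * mittagLeffler α β z := by
  have hcos : cos φ < 0 := cos_neg_of_pi_div_two_lt_of_lt hφ (by linarith [pi_pos])
  rw [← (hasSum_hankelIntegral_mlKernel hα (by linarith [pi_pos]) hcos hz (1 - β)).tsum_eq,
    mittagLeffler, ← tsum_mul_left]
  congr 1; ext k
  rw [hankelIntegral_hexp hφ hφ']
  have e : ((1 - (1 - β - k * α) : ℝ) : ℂ) = α * k + β := by push_cast; ring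
  rw [e]
  ring

lemma rectIntegral_mlKernel {α φ a b c : ℝ} {z : ℂ} (hα : 0 < α) (hαφ : α * φ ≤ π) (hz : z ≠ 0)
    (harg : |z.arg| < α * φ) (hb : b < Real.log ‖z‖ / α) (ha : Real.log ‖z‖ / α < a) :
    rectIntegral b a (-φ) φ (mlKernel α c z) =
      2 * π * Complex.I * (hexp c (Complex.log z / α) / (α * z)) := by
  have hα' : (α : ℂ) ≠ 0 := by exact_mod_cast hα.ne'
  set w₀ : ℂ := Complex.log z / α with hw₀
  have hre : w₀.re = Real.log ‖z‖ / α := by rw [hw₀, Complex.div_ofReal_re, Complex.log_re]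
  have him : w₀.im = z.arg / α := by rw [hw₀, Complex.div_ofReal_im, Complex.log_im]
  have hαw₀ : α * w₀ = Complex.log z := by rw [hw₀]; field_simp
  have him' : |w₀.im| < φ := by
    rw [him, abs_div, abs_of_pos hα, div_lt_iff₀ hα]; linarith
  have hφ : 0 < φ := (abs_nonneg _).trans_lt him'
  set q : ℂ → ℂ := fun w => Complex.exp (α * w) - z with hq
  have hq0 : q w₀ = 0 := by simp only [hq, hαw₀, Complex.exp_log hz, sub_self]
  have hqd : Differentiable ℂ q := by simp only [hq]; fun_prop
  have hq' : deriv q w₀ = α * z := by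
    have : HasDerivAt q (α * z) w₀ := by
      have h := (((hasDerivAt_id w₀).const_mul (α : ℂ)).cexp).sub_const z
      refine h.congr_deriv ?_
      simp only [id, hαw₀, Complex.exp_log hz]; ring
    exact this.deriv
  have hqne : ∀ w : ℂ, |w.im| ≤ φ → w ≠ w₀ → q w ≠ 0 := by
    intro w hw hne h
    have h1 : Complex.exp (α * w) = Complex.exp (α * w₀) := by
      rw [hαw₀, Complex.exp_log hz]; exact sub_eq_zero.1 h
    obtain ⟨n, hn⟩ := Complex.exp_eq_exp_iff_exists_int.1 h1
    have h2 : α * w.im = α * w₀.im + n * (2 * π) := by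
      simpa using congrArg Complex.im hn
    have h3 : |α * w.im| ≤ α * φ := by rw [abs_mul, abs_of_pos hα]; gcongr
    have h4 : |α * w₀.im| < α * φ := by rw [abs_mul, abs_of_pos hα]; gcongr
    rw [abs_le] at h3
    rw [abs_lt] at h4
    have hn1 : (n : ℝ) < 1 := by
      by_contra! h5; nlinarith [pi_pos]
    have hn2 : (-1 : ℝ) < n := by
      by_contra! h5; nlinarith [pi_pos]
    have hn0 : n = 0 := by
      have a1 : n < 1 := by exact_mod_cast hn1
      have a2 : -1 < n := by exact_mod_cast hn2
      omega
    rw [hn0] at hn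
    exact hne (mul_left_cancel₀ hα' (by simpa using hn))
  have hdne : ∀ w : ℂ, |w.im| ≤ φ → dslope q w₀ w ≠ 0 := by
    intro w hw h
    rcases eq_or_ne w w₀ with rfl | hne
    · rw [dslope_same, hq'] at h
      exact mul_ne_zero hα' hz h
    · have := sub_smul_dslope q w₀ w
      rw [h, smul_zero, hq0, sub_zero] at this
      exact hqne w hw hne this.symm
  have hdd : Differentiable ℂ (dslope q w₀) := by
    rw [← differentiableOn_univ] at hqd ⊢
    exact (Complex.differentiableOn_dslope univ_mem).2 hqd
  have hK : mlKernel α c z = fun w => (hexp c w / dslope q w₀ w) / (w - w₀) := by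
    ext w
    have := sub_smul_dslope q w₀ w
    rw [hq0, sub_zero, smul_eq_mul] at this
    rw [div_div, mul_comm, this, mlKernel]
  rw [hK, rectIntegral_div_sub (by rwa [hre]) (by rwa [hre]) (abs_lt.1 him').1 (abs_lt.1 him').2,
    dslope_same, hq']
  refine (differentiable_hexp c).differentiableOn.div hdd.differentiableOn fun w hw => hdne w ?_
  have := hw.2
  rw [mem_preimage, uIcc_of_le (by linarith)] at this
  exact abs_le.2 this

lemma mittagLeffler_eq_add_hankelIntegral {α φ δ : ℝ} {z : ℂ} (hα : 0 < α) (hφ : π / 2 < φ)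
    (hφ' : φ ≤ π) (hαφ : α * φ ≤ π) (hz : 1 < ‖z‖) (harg : |z.arg| < α * φ) (hδ : 0 < δ)
    (hq : ∀ w ∈ hankelContour φ 0, δ ≤ ‖Complex.exp (α * w) - z‖) (β : ℝ) :
    mittagLeffler α β z = hexp (1 - β + α) (Complex.log z / α) / (α * z) +
      (2 * π * Complex.I)⁻¹ * hankelIntegral φ 0 (mlKernel α (1 - β + α) z) := by
  have hφ0 : 0 ≤ φ := by linarith [pi_pos]
  have hcos : cos φ < 0 := cos_neg_of_pi_div_two_lt_of_lt hφ (by linarith [pi_pos])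
  have hlog : 0 < Real.log ‖z‖ := Real.log_pos hz
  have hz0 : z ≠ 0 := norm_pos_iff.1 (by linarith)
  set a : ℝ := Real.log ‖z‖ / α + 1 with ha
  have hza : ‖z‖ < exp (α * a) := by
    rw [← Real.log_lt_iff_lt_exp (by linarith), ha, mul_add, mul_div_cancel₀ _ hα.ne']
    linarith
  have hδa : 0 < exp (α * a) - ‖z‖ := sub_pos.2 hza
  have hqa : ∀ w ∈ hankelContour φ a, exp (α * a) - ‖z‖ ≤ ‖Complex.exp (α * w) - z‖ := by
    intro w hw
    have h1 := norm_sub_norm_le (Complex.exp (α * w)) z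
    rw [norm_exp_ofReal_mul] at h1
    have h2 := exp_le_exp.2 (mul_le_mul_of_nonneg_left (le_re_of_mem_hankelContour hw) hα.le)
    linarith
  have h := hankelIntegral_sub_hankelIntegral
    (hankelIntegrable_mlKernel hφ0 hcos hδa hqa (1 - β + α))
    (hankelIntegrable_mlKernel hφ0 hcos hδ hq (1 - β + α))
  rw [hankelIntegral_mlKernel_eq_mittagLeffler hα hφ hφ' hza,
    rectIntegral_mlKernel hα hαφ hz0 harg (by positivity) (by linarith)] at h
  have hpi : (2 * π * Complex.I : ℂ) ≠ 0 := Complex.two_pi_I_ne_zero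
  refine mul_left_cancel₀ hpi ?_
  rw [mul_add, mul_inv_cancel_left₀ hpi]
  linear_combination h

lemma sqrt_mul_le_norm_sub (s ψ R θ : ℝ) (hR : 0 ≤ R) (hs : 0 ≤ s) :
    √((1 - cos (ψ - θ)) / 2) * R ≤
      ‖(s : ℂ) * Complex.exp (ψ * Complex.I) - R * Complex.exp (θ * Complex.I)‖ := by
  have hC := cos_le_one (ψ - θ)
  have hC' := neg_one_le_cos (ψ - θ)
  refine le_of_sq_le_sq ?_ (norm_nonneg _)
  rw [mul_pow, Real.sq_sqrt (by linarith), Complex.sq_norm, Complex.normSq_apply]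
  simp only [Complex.sub_re, Complex.sub_im, Complex.re_ofReal_mul, Complex.im_ofReal_mul,
    Complex.exp_ofReal_mul_I_re, Complex.exp_ofReal_mul_I_im]
  have h1 : (s * cos ψ - R * cos θ) * (s * cos ψ - R * cos θ) +
      (s * sin ψ - R * sin θ) * (s * sin ψ - R * sin θ) =
      s ^ 2 - 2 * s * R * cos (ψ - θ) + R ^ 2 := by
    rw [cos_sub]
    linear_combination s ^ 2 * sin_sq_add_cos_sq ψ + R ^ 2 * sin_sq_add_cos_sq θ
  rw [h1]
  nlinarith [mul_nonneg (by linarith : 0 ≤ 1 + cos (ψ - θ)) (sq_nonneg (s - R)),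
    mul_nonneg (by linarith : 0 ≤ 1 - cos (ψ - θ)) (mul_nonneg hs hR),
    mul_nonneg (by linarith : 0 ≤ 1 - cos (ψ - θ)) (sq_nonneg s)]

lemma exists_mul_le_norm_exp_sub {α φ θ : ℝ} (hαφ : α * φ ≤ π) (hθ : |θ| < α * φ) :
    ∃ δ > 0, ∀ R : ℝ, 2 ≤ R → ∀ w ∈ hankelContour φ 0,
      δ * R ≤ ‖Complex.exp (α * w) - R * Complex.exp (θ * Complex.I)‖ := by
  rw [abs_lt] at hθ
  have hcos : ∀ x : ℝ, 0 < x → x < 2 * π → 0 < √((1 - cos x) / 2) := by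
    intro x h0 h1
    refine Real.sqrt_pos.2 ?_
    have : cos x ≠ 1 := fun h =>
      h0.ne' ((cos_eq_one_iff_of_lt_of_lt (by linarith) h1).1 h)
    have := lt_of_le_of_ne (cos_le_one x) this
    linarith
  have hp := hcos (α * φ - θ) (by linarith) (by linarith)
  have hm := hcos (α * φ + θ) (by linarith) (by linarith)
  refine ⟨min (1 / 2) (min √((1 - cos (α * φ - θ)) / 2) √((1 - cos (α * φ + θ)) / 2)),
    by positivity, fun R hR w hw => ?_⟩
  have hR0 : 0 ≤ R := by linarith
  have hray : ∀ ψ : ℝ, α * w.im = ψ → √((1 - cos (ψ - θ)) / 2) * R ≤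
      ‖Complex.exp (α * w) - R * Complex.exp (θ * Complex.I)‖ := by
    intro ψ hψ
    have e : Complex.exp (α * w) = (exp (α * w.re) : ℝ) * Complex.exp (ψ * Complex.I) := by
      rw [Complex.ofReal_exp, ← Complex.exp_add, ← hψ]
      congr 1
      conv_lhs => rw [← Complex.re_add_im w]
      push_cast; ring
    rw [e]
    exact sqrt_mul_le_norm_sub _ ψ R θ hR0 (exp_pos _).le
  rcases hw with ⟨-, h | h⟩ | ⟨h, -⟩
  · refine le_trans ?_ (hray (α * φ) (by rw [h]))
    gcongr
    exact (min_le_right _ _).trans (min_le_left _ _)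
  · refine le_trans ?_ (hray (-(α * φ)) (by rw [h]; ring))
    rw [show -(α * φ) - θ = -(α * φ + θ) by ring, cos_neg]
    gcongr
    exact (min_le_right _ _).trans (min_le_right _ _)
  · have h1 := norm_sub_norm_le ((R : ℂ) * Complex.exp (θ * Complex.I)) (Complex.exp (α * w))
    rw [norm_sub_rev, norm_mul, Complex.norm_exp_ofReal_mul_I, Complex.norm_real,
      Real.norm_of_nonneg hR0, norm_exp_ofReal_mul, h, mul_zero, Real.exp_zero] at h1
    have h2 := mul_le_mul_of_nonneg_right (min_le_left (1 / 2 : ℝ)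
      (min √((1 - cos (α * φ - θ)) / 2) √((1 - cos (α * φ + θ)) / 2))) hR0
    linarith

/-- The asymptotic expansion of the Mittag-Leffler function along a ray `arg z = θ`, with an
explicit remainder bound. -/
lemma exists_norm_mittagLeffler_sub_add_le {α φ θ : ℝ} (hα : 0 < α) (hφ : π / 2 < φ)
    (hφ' : φ ≤ π) (hαφ : α * φ ≤ π) (hθ : |θ| < α * φ) (β : ℝ) (p : ℕ) :
    ∃ C : ℝ, ∀ R : ℝ, 2 ≤ R → ∀ z : ℂ, z = R * Complex.exp (θ * Complex.I) →
      ‖mittagLeffler α β z -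
        (1 / (α : ℂ)) * z ^ (((1 - β) / α : ℝ) : ℂ) * Complex.exp (z ^ ((1 / α : ℝ) : ℂ)) +
        ∑ k ∈ Finset.Icc 1 p, z ^ (-(k : ℤ)) / Complex.Gamma ((β : ℂ) - (α : ℂ) * (k : ℕ))‖ ≤
      C * (R ^ (p + 1))⁻¹ := by
  obtain ⟨δ, hδ, hlower⟩ := exists_mul_le_norm_exp_sub hαφ hθ
  have hφ0 : 0 ≤ φ := by linarith [pi_pos]
  have hcos : cos φ < 0 := cos_neg_of_pi_div_two_lt_of_lt hφ (by linarith [pi_pos])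
  have hpi : (2 * π * Complex.I : ℂ) ≠ 0 := Complex.two_pi_I_ne_zero
  have hα' : (α : ℂ) ≠ 0 := by exact_mod_cast hα.ne'
  refine ⟨‖(2 * π * Complex.I : ℂ)⁻¹‖ * (δ⁻¹ * hankelMass φ 0 (1 - β + (p + 1) * α)),
    fun R hR z hz => ?_⟩
  have hR0 : 0 < R := by linarith
  have hnorm : ‖z‖ = R := by
    rw [hz, norm_mul, Complex.norm_exp_ofReal_mul_I, Complex.norm_real,
      Real.norm_of_nonneg hR0.le, mul_one]
  have hz0 : z ≠ 0 := norm_pos_iff.1 (by linarith)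
  have harg : z.arg = θ := by
    rw [abs_lt] at hθ
    rw [hz, Complex.arg_real_mul _ hR0, Complex.arg_exp_mul_I,
      toIocMod_eq_self]
    constructor <;> linarith
  have hq : ∀ w ∈ hankelContour φ 0, δ * R ≤ ‖Complex.exp (α * w) - z‖ := by
    rw [hz]; exact hlower R hR
  have hδR : 0 < δ * R := by positivity
  have hmain := mittagLeffler_eq_add_hankelIntegral hα hφ hφ' hαφ (by linarith)
    (by rwa [harg]) hδR hq β
  have hres : hexp (1 - β + α) (Complex.log z / α) / (α * z) =
      (1 / (α : ℂ)) * z ^ (((1 - β) / α : ℝ) : ℂ) * Complex.exp (z ^ ((1 / α : ℝ) : ℂ)) := by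
    rw [hexp_add, mul_div_cancel₀ _ hα', Complex.exp_log hz0, hexp,
      Complex.cpow_def_of_ne_zero hz0, Complex.cpow_def_of_ne_zero hz0, Complex.exp_add]
    have e1 : Complex.log z * ((1 / α : ℝ) : ℂ) = Complex.log z / α := by push_cast; ring
    have e2 : Complex.log z * (((1 - β) / α : ℝ) : ℂ) = ((1 - β : ℝ) : ℂ) * (Complex.log z / α) := by
      push_cast; ring
    rw [e1, e2]
    field_simp
  have hexpand := hankelIntegral_mlKernel_eq_neg_sum_add hφ0 hcos hδR hq hz0 (1 - β) p
  have hT : ∀ k : ℕ, z ^ (-(k : ℤ)) * hankelIntegral φ 0 (hexp (1 - β + k * α)) =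
      2 * π * Complex.I * (z ^ (-(k : ℤ)) / Complex.Gamma ((β : ℂ) - (α : ℂ) * (k : ℕ))) := by
    intro k
    have e : ((1 - (1 - β + k * α) : ℝ) : ℂ) = β - α * k := by push_cast; ring
    rw [hankelIntegral_hexp hφ hφ', e]
    ring
  rw [Finset.sum_congr rfl fun k _ => hT k, ← Finset.mul_sum] at hexpand
  rw [hmain, hres, hexpand, mul_add, mul_neg, inv_mul_cancel_left₀ hpi]
  set V := hankelIntegral φ 0 (mlKernel α (1 - β + (p + 1) * α) z) with hV
  have hVle : ‖V‖ ≤ (δ * R)⁻¹ * hankelMass φ 0 (1 - β + (p + 1) * α) :=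
    norm_hankelIntegral_le hφ0 hcos fun w hw => norm_mlKernel_le hδR hq _ hw
  calc _ = ‖(2 * π * Complex.I : ℂ)⁻¹ * (z ^ (-(p : ℤ)) * V)‖ := by congr 1; ring
    _ = ‖(2 * π * Complex.I : ℂ)⁻¹‖ * ((R ^ p)⁻¹ * ‖V‖) := by
      rw [norm_mul, norm_mul, norm_zpow, hnorm, zpow_neg, zpow_natCast]
    _ ≤ ‖(2 * π * Complex.I : ℂ)⁻¹‖ *
        ((R ^ p)⁻¹ * ((δ * R)⁻¹ * hankelMass φ 0 (1 - β + (p + 1) * α))) := by gcongr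
    _ = _ := by rw [mul_inv, pow_succ, mul_inv]; ring

/-- Asymptotic expansion of the Mittag-Leffler function: for `0 < α < 2`, `β ∈ ℝ`,
`απ/2 < μ < min{π, πα}`, integer `p ≥ 1`, `r > 0` and `|θ| ≤ μ`, as `t → ∞`,
`E_{α,β}(re^{iθ}t^α) − (1/α)(re^{iθ}t^α)^{(1−β)/α} exp((re^{iθ}t^α)^{1/α})
  + ∑_{k=1}^p (re^{iθ}t^α)^{−k}/Γ(β−αk) = O(t^{−α(1+p)})`,
complex powers taken with the principal branch. -/
theorem mittagLeffler_asymptotic_expansion (α β μ : ℝ) (p : ℕ)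
    (hα₀ : 0 < α) (hα₂ : α < 2) (hμ₁ : α * π / 2 < μ) (hμ₂ : μ < min π (π * α))
    (hp : 1 ≤ p) (r : ℝ) (hr : 0 < r) (θ : ℝ) (hθ : |θ| ≤ μ) :
    (fun t : ℝ =>
        mittagLeffler α β ((r : ℂ) * Complex.exp (θ * Complex.I) * ((t ^ α : ℝ) : ℂ)) -
          (1 / (α : ℂ)) *
            ((r : ℂ) * Complex.exp (θ * Complex.I) * ((t ^ α : ℝ) : ℂ)) ^
              (((1 - β) / α : ℝ) : ℂ) *
            Complex.exp
              (((r : ℂ) * Complex.exp (θ * Complex.I) * ((t ^ α : ℝ) : ℂ)) ^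
                ((1 / α : ℝ) : ℂ)) +
          ∑ k ∈ Finset.Icc 1 p,
            ((r : ℂ) * Complex.exp (θ * Complex.I) * ((t ^ α : ℝ) : ℂ)) ^ (-(k : ℤ)) /
              Complex.Gamma ((β : ℂ) - (α : ℂ) * (k : ℕ))) =O[atTop]
      (fun t : ℝ => t ^ (-(α * (1 + p)))) := by
  have hα0' := hα₀.ne'
  have hαφ : α * min π (π / α) = min π (π * α) := by
    rw [mul_min_of_nonneg _ _ hα₀.le, mul_div_cancel₀ _ hα0', min_comm, mul_comm]
  have hφ : π / 2 < min π (π / α) :=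
    lt_min (by linarith [pi_pos]) (div_lt_div_of_pos_left pi_pos hα₀ hα₂)
  obtain ⟨C, hC⟩ := exists_norm_mittagLeffler_sub_add_le hα₀ hφ (min_le_left _ _)
    (hαφ.trans_le (min_le_left _ _)) (by rw [hαφ]; exact hθ.trans_lt hμ₂) β p
  have hR : Tendsto (fun t : ℝ => r * t ^ α) atTop atTop :=
    (tendsto_rpow_atTop hα₀).const_mul_atTop hr
  refine IsBigO.of_bound (C * (r ^ (p + 1))⁻¹) ?_
  filter_upwards [hR.eventually_ge_atTop 2, eventually_gt_atTop 0] with t ht ht0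
  refine (hC (r * t ^ α) ht _ (by push_cast; ring)).trans_eq ?_
  rw [Real.norm_of_nonneg (rpow_nonneg ht0.le _), mul_pow, mul_inv, rpow_neg ht0.le, rpow_mul ht0.le,
    ← rpow_natCast (t ^ α) (p + 1)]
  push_cast
  rw [add_comm (1 : ℝ)]
  ring
end

section
/- Let 0 < α < 1 and let λ ∈ ℂ be nonzero with |arg(λ)| > απ/2. Then E_α(λ t^α) = O(t^{−α}) as t → ∞; in particular E_α(λ t^α) → 0 as t → ∞. -/
open Filter Asymptotics Real

open MeasureTheory

theorem norm_ofReal_cpow_mul_cexp_neg_mul (b : ℝ) (s : ℂ) {x : ℝ} (hx : 0 < x) :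
    ‖(x : ℂ) ^ (b : ℂ) * Complex.exp (-(s * x))‖ = x ^ b * Real.exp (-s.re * x) := by
  rw [norm_mul, Complex.norm_cpow_real, Complex.norm_exp, Complex.norm_real, norm_of_nonneg hx.le]
  simp

theorem aestronglyMeasurable_cpow_mul_cexp_neg_mul (b : ℝ) (s : ℂ) :
    AEStronglyMeasurable (fun x : ℝ => (x : ℂ) ^ (b : ℂ) * Complex.exp (-(s * x)))
      (volume.restrict (Set.Ioi 0)) := by
  refine ContinuousOn.aestronglyMeasurable (fun x hx => ?_) measurableSet_Ioi
  have : (x : ℂ) ∈ Complex.slitPlane := Complex.ofReal_mem_slitPlane.2 hx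
  refine ContinuousAt.continuousWithinAt (ContinuousAt.mul ?_ (by fun_prop))
  exact (continuousAt_cpow_const this).comp Complex.continuous_ofReal.continuousAt

theorem integrableOn_rpow_mul_exp_neg_mul {b c : ℝ} (hb : -1 < b) (hc : 0 < c) :
    IntegrableOn (fun x : ℝ => x ^ b * Real.exp (-c * x)) (Set.Ioi 0) := by
  simpa using integrableOn_rpow_mul_exp_neg_mul_rpow hb one_pos hc

theorem integrableOn_cpow_mul_cexp_neg_mul {b : ℝ} (hb : -1 < b) {s : ℂ} (hs : 0 < s.re) :
    IntegrableOn (fun x : ℝ => (x : ℂ) ^ (b : ℂ) * Complex.exp (-(s * x))) (Set.Ioi 0) := by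
  refine (integrableOn_rpow_mul_exp_neg_mul hb hs).mono'
    (aestronglyMeasurable_cpow_mul_cexp_neg_mul b s) ?_
  filter_upwards [ae_restrict_mem measurableSet_Ioi] with x hx
  exact (norm_ofReal_cpow_mul_cexp_neg_mul b s hx).le

theorem differentiableOn_integral_cpow_mul_cexp_neg_mul {b : ℝ} (hb : -1 < b) :
    DifferentiableOn ℂ
      (fun s : ℂ => ∫ x : ℝ in Set.Ioi 0, (x : ℂ) ^ (b : ℂ) * Complex.exp (-(s * x)))
      {s | 0 < s.re} := by
  intro s hs
  have hs : 0 < s.re := hs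
  have hU : {w : ℂ | s.re / 2 < w.re} ∈ nhds s :=
    (isOpen_lt continuous_const Complex.continuous_re).mem_nhds (half_lt_self hs)
  refine DifferentiableAt.differentiableWithinAt (HasDerivAt.differentiableAt
    (hasDerivAt_integral_of_dominated_loc_of_deriv_le
      (F' := fun w x => (x : ℂ) ^ (b : ℂ) * (Complex.exp (-(w * x)) * (-x)))
      (bound := fun x => x ^ (b + 1) * Real.exp (-(s.re / 2) * x)) hU
      (Eventually.of_forall fun w => aestronglyMeasurable_cpow_mul_cexp_neg_mul b w)
      (integrableOn_cpow_mul_cexp_neg_mul hb hs) ?_ ?_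
      (integrableOn_rpow_mul_exp_neg_mul (by linarith) (by linarith)) ?_).2)
  · have h1 : AEStronglyMeasurable (fun x : ℝ => (-x : ℂ)) (volume.restrict (Set.Ioi 0)) :=
      Continuous.aestronglyMeasurable (by fun_prop)
    refine ((aestronglyMeasurable_cpow_mul_cexp_neg_mul b s).mul h1).congr
      (Eventually.of_forall fun x => ?_)
    simp only [Pi.mul_apply, mul_assoc]
  · filter_upwards [ae_restrict_mem measurableSet_Ioi] with x hx w hw
    have hx : 0 < x := hx
    have hw : s.re / 2 < w.re := hw
    rw [← mul_assoc, norm_mul, norm_ofReal_cpow_mul_cexp_neg_mul b w hx, norm_neg,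
      Complex.norm_real, norm_of_nonneg hx.le, rpow_add_one hx.ne', mul_right_comm]
    gcongr
  · refine Eventually.of_forall fun x w _ => ?_
    have h1 : HasDerivAt (fun w : ℂ => -(w * x)) (-x : ℂ) w := by
      simpa using (hasDerivAt_mul_const (x : ℂ) (x := w)).fun_neg
    exact h1.cexp.const_mul _

/-- The Laplace transform of `x ^ (b - 1)` on the right half plane. -/
theorem integral_cpow_mul_cexp_neg_mul_Ioi {b : ℝ} (hb : 0 < b) {s : ℂ} (hs : 0 < s.re) :
    ∫ x : ℝ in Set.Ioi 0, (x : ℂ) ^ ((b - 1 : ℝ) : ℂ) * Complex.exp (-(s * x)) =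
      s ^ (-(b : ℂ)) * Complex.Gamma b := by
  have hopen : IsOpen {s : ℂ | 0 < s.re} := isOpen_lt continuous_const Complex.continuous_re
  have hA := (differentiableOn_integral_cpow_mul_cexp_neg_mul
    (show -1 < b - 1 by linarith)).analyticOnNhd hopen
  have hB : AnalyticOnNhd ℂ (fun s : ℂ => s ^ (-(b : ℂ)) * Complex.Gamma b) {s | 0 < s.re} := by
    refine DifferentiableOn.analyticOnNhd (fun w hw => ?_) hopen
    exact ((differentiableAt_id.cpow_const (Or.inl hw)).mul_const _).differentiableWithinAt
  refine hA.eqOn_of_preconnected_of_frequently_eq hB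
    (convex_halfSpace_re_gt 0).isPreconnected (z₀ := 1) (by simp) ?_ hs
  have hreal : ∀ r : ℝ, 0 < r →
      ∫ x : ℝ in Set.Ioi 0, (x : ℂ) ^ ((b - 1 : ℝ) : ℂ) * Complex.exp (-((r : ℂ) * x)) =
        (r : ℂ) ^ (-(b : ℂ)) * Complex.Gamma b := by
    intro r hr
    have h := Complex.integral_cpow_mul_exp_neg_mul_Ioi (a := b) (by simpa) hr
    push_cast
    rw [h, one_div, Complex.inv_cpow _ _ ?_, Complex.cpow_neg]
    rw [Complex.arg_ofReal_of_nonneg hr.le]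
    exact pi_pos.ne
  have hT : Tendsto (fun r : ℝ => (r : ℂ)) (nhdsWithin 1 {1}ᶜ) (nhdsWithin (1 : ℂ) {1}ᶜ) := by
    refine tendsto_nhdsWithin_of_tendsto_nhds_of_eventually_within _ ?_ ?_
    · exact (Complex.continuous_ofReal.tendsto' 1 1 (by simp)).mono_left nhdsWithin_le_nhds
    · filter_upwards [self_mem_nhdsWithin] with r hr
      simpa using hr
  refine hT.frequently (Eventually.frequently ?_)
  filter_upwards [nhdsWithin_le_nhds (lt_mem_nhds (zero_lt_one (α := ℝ)))] with r hr
  exact hreal r hr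

theorem one_add_abs_div_two_le_norm {c : ℝ} (hc : 1 ≤ c) (y : ℝ) :
    (1 + |y|) / 2 ≤ ‖(c + y * Complex.I : ℂ)‖ := by
  have h1 := Complex.abs_re_le_norm (c + y * Complex.I : ℂ)
  have h2 := Complex.abs_im_le_norm (c + y * Complex.I : ℂ)
  simp at h1 h2
  have := le_abs_self c
  linarith

theorem integrable_norm_add_mul_I_rpow_neg {c b : ℝ} (hc : 1 ≤ c) (hb : 1 < b) :
    Integrable (fun y : ℝ => ‖(c + y * Complex.I : ℂ)‖ ^ (-b)) := by
  have h := (integrable_one_add_norm (E := ℝ) (μ := volume) (r := b) (by simpa)).mul_const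
    ((1 / 2 : ℝ) ^ (-b))
  have hpos : ∀ y : ℝ, 0 < ‖(c + y * Complex.I : ℂ)‖ := fun y =>
    lt_of_lt_of_le (by positivity) (one_add_abs_div_two_le_norm hc y)
  refine h.mono' (Continuous.aestronglyMeasurable ?_) (Eventually.of_forall fun y => ?_)
  · exact Continuous.rpow_const (by fun_prop) fun y => Or.inl (hpos y).ne'
  · rw [norm_of_nonneg (by positivity), ← mul_rpow (by positivity) (by norm_num), Real.norm_eq_abs]
    refine rpow_le_rpow_of_nonpos (by positivity) ?_ (by linarith)
    linarith [one_add_abs_div_two_le_norm hc y]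

theorem continuous_add_mul_I_cpow {c : ℝ} (hc : 0 < c) (b : ℂ) :
    Continuous (fun y : ℝ => (c + y * Complex.I : ℂ) ^ b) := by
  refine continuous_iff_continuousAt.2 fun y => ?_
  have : (c + y * Complex.I : ℂ) ∈ Complex.slitPlane := Or.inl (by simpa)
  exact (continuousAt_cpow_const this).comp (f := fun y : ℝ => (c + y * Complex.I : ℂ))
    (by fun_prop)

/-- Laplace's integral for the reciprocal Gamma function along a vertical line. -/
theorem integral_cexp_mul_cpow_neg_vertical {c b : ℝ} (hc : 1 ≤ c) (hb : 1 < b) :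
    ∫ y : ℝ, Complex.exp (c + y * Complex.I) * (c + y * Complex.I : ℂ) ^ (-(b : ℂ)) =
      2 * π / Complex.Gamma b := by
  have hc0 : 0 < c := by linarith
  have hG : Complex.Gamma b ≠ 0 := Complex.Gamma_ne_zero_of_re_pos (by simp; linarith)
  set f : ℝ → ℂ := (Set.Ioi 0).indicator
    fun x : ℝ => (x : ℂ) ^ ((b - 1 : ℝ) : ℂ) * Complex.exp (-(c * x)) with hf
  have hfi : Integrable f := by
    rw [hf, integrable_indicator_iff measurableSet_Ioi]
    exact integrableOn_cpow_mul_cexp_neg_mul (by linarith) (by simpa)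
  have hF : ∀ w : ℝ, FourierTransform.fourier f w =
      (c + (2 * π * w : ℝ) * Complex.I : ℂ) ^ (-(b : ℂ)) * Complex.Gamma b := by
    intro w
    rw [← integral_cpow_mul_cexp_neg_mul_Ioi (by linarith) (by simpa),
      Real.fourier_real_eq_integral_exp_smul, ← integral_indicator measurableSet_Ioi]
    congr 1 with x
    simp only [hf, Set.indicator_apply, smul_eq_mul]
    split_ifs
    · rw [mul_left_comm, ← Complex.exp_add]
      congr 2
      push_cast
      ring
    · simp
  have hFi : Integrable (FourierTransform.fourier f) := by
    have h1 : Integrable fun y : ℝ => (c + y * Complex.I : ℂ) ^ (-(b : ℂ)) := by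
      refine (integrable_norm_add_mul_I_rpow_neg hc hb).mono'
        (continuous_add_mul_I_cpow hc0 _).aestronglyMeasurable (Eventually.of_forall fun y => ?_)
      rw [← Complex.ofReal_neg, Complex.norm_cpow_real]
    rw [funext hF]
    exact (h1.comp_mul_left' (by positivity : 2 * π ≠ 0)).mul_const _
  have hcont : ContinuousAt f 1 := by
    have h1 : ContinuousAt
        (fun x : ℝ => (x : ℂ) ^ ((b - 1 : ℝ) : ℂ) * Complex.exp (-(c * x))) 1 := by
      refine ContinuousAt.mul ?_ (by fun_prop)
      exact (continuousAt_cpow_const (by simp)).comp Complex.continuous_ofReal.continuousAt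
    refine h1.congr ?_
    filter_upwards [lt_mem_nhds (zero_lt_one (α := ℝ))] with x hx
    rw [hf, Set.indicator_of_mem (Set.mem_Ioi.2 hx)]
  have hinv := hfi.fourierInv_fourier_eq hFi hcont
  rw [Real.fourierInv_eq'] at hinv
  have hf1 : f 1 = Complex.exp (-c) := by
    rw [hf, Set.indicator_of_mem (by simp)]
    simp
  have hcomp := Measure.integral_comp_mul_left
    (fun y : ℝ => Complex.exp (c + y * Complex.I) * (c + y * Complex.I : ℂ) ^ (-(b : ℂ))) (2 * π)
  have hkey : ∫ w : ℝ, Complex.exp (c + (2 * π * w : ℝ) * Complex.I) *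
      (c + (2 * π * w : ℝ) * Complex.I : ℂ) ^ (-(b : ℂ)) = 1 / Complex.Gamma b := by
    have : ∀ w : ℝ, Complex.exp (c + (2 * π * w : ℝ) * Complex.I) *
        (c + (2 * π * w : ℝ) * Complex.I : ℂ) ^ (-(b : ℂ)) =
        Complex.exp c / Complex.Gamma b *
        (Complex.exp (↑(2 * π * inner ℝ w 1) * Complex.I) • FourierTransform.fourier f w) := by
      intro w
      rw [hF, Complex.exp_add, smul_eq_mul]
      simp only [RCLike.inner_apply, conj_trivial, one_mul]
      field_simp
    simp_rw [this]
    rw [integral_const_mul, hinv, hf1, div_mul_eq_mul_div, ← Complex.exp_add]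
    simp
  rw [hkey, abs_of_pos (by positivity), Complex.real_smul, Complex.ofReal_inv] at hcomp
  have h2pi : ((2 * π : ℝ) : ℂ) ≠ 0 := by exact_mod_cast (by positivity : 2 * π ≠ 0)
  rw [eq_inv_mul_iff_mul_eq₀ h2pi] at hcomp
  rw [← hcomp]
  push_cast
  ring

/-- Two vertical line integrals of a holomorphic function with enough decay agree. -/
theorem integral_vertical_eq_of_norm_le {f : ℂ → ℂ} {b c C : ℝ} (hc : 1 ≤ c) (hb : 1 < b)
    (hf : DifferentiableOn ℂ f {s | 0 < s.re})
    (hC : ∀ s : ℂ, 1 ≤ s.re → s.re ≤ c → ‖f s‖ ≤ C * ‖s‖ ^ (-b)) :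
    ∫ y : ℝ, f (c + y * Complex.I) = ∫ y : ℝ, f ((1 : ℝ) + y * Complex.I) := by
  have hC0 : 0 ≤ C := by
    have := (norm_nonneg _).trans (hC 1 (by simp) (by simpa))
    simpa using this
  have hint : ∀ a : ℝ, 1 ≤ a → a ≤ c → Integrable fun y : ℝ => f (a + y * Complex.I) := by
    intro a ha hac
    refine ((integrable_norm_add_mul_I_rpow_neg ha hb).const_mul C).mono'
      (Continuous.aestronglyMeasurable ?_)
      (Eventually.of_forall fun y => hC _ (by simpa) (by simpa))
    refine hf.continuousOn.comp_continuous (by fun_prop) fun y => ?_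
    simp only [Set.mem_ofPred_eq, Complex.add_re, Complex.ofReal_re, Complex.re_ofReal_mul,
      Complex.I_re, mul_zero, add_zero]
    linarith
  have hhor : ∀ σ : ℝ, |σ| = 1 → Tendsto
      (fun T : ℝ => ∫ x : ℝ in 1..c, f (x + (σ * T : ℝ) * Complex.I)) atTop (nhds 0) := by
    intro σ hσ
    have hlim : Tendsto (fun T : ℝ => C * T ^ (-b) * |c - 1|) atTop (nhds 0) := by
      simpa using ((tendsto_rpow_neg_atTop (by linarith : 0 < b)).const_mul C).mul_const |c - 1|
    refine squeeze_zero_norm' ?_ hlim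
    filter_upwards [eventually_gt_atTop 0] with T hT
    refine intervalIntegral.norm_integral_le_of_norm_le_const fun x hx => ?_
    rw [Set.uIoc_of_le hc] at hx
    refine (hC _ (by simpa using hx.1.le) (by simpa using hx.2)).trans ?_
    have hTn : T ≤ ‖(x + (σ * T : ℝ) * Complex.I : ℂ)‖ := by
      have h2 := Complex.abs_im_le_norm (x + (σ * T : ℝ) * Complex.I : ℂ)
      have h3 : (x + (σ * T : ℝ) * Complex.I : ℂ).im = σ * T := by simp
      rwa [h3, abs_mul, hσ, one_mul, abs_of_pos hT] at h2
    exact mul_le_mul_of_nonneg_left (rpow_le_rpow_of_nonpos hT hTn (by linarith)) hC0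
  have hrect : ∀ T : ℝ, Complex.I * (∫ y : ℝ in -T..T, f (c + y * Complex.I)) -
      Complex.I * (∫ y : ℝ in -T..T, f ((1 : ℝ) + y * Complex.I)) =
      (∫ x : ℝ in 1..c, f (x + ((1 : ℝ) * T : ℝ) * Complex.I)) -
        ∫ x : ℝ in 1..c, f (x + ((-1 : ℝ) * T : ℝ) * Complex.I) := by
    intro T
    have h := Complex.integral_boundary_rect_eq_zero_of_differentiableOn f
      ⟨1, -T⟩ ⟨c, T⟩ (hf.mono fun s hs => ?_)
    · simp only [smul_eq_mul] at h
      simp only [one_mul, neg_one_mul]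
      linear_combination h
    · have h1 := (Complex.mem_reProdIm.1 hs).1
      simp only [Set.uIcc_of_le hc] at h1
      exact lt_of_lt_of_le one_pos h1.1
  have hv : ∀ a : ℝ, 1 ≤ a → a ≤ c → Tendsto
      (fun T : ℝ => ∫ y : ℝ in -T..T, f (a + y * Complex.I))
      atTop (nhds (∫ y : ℝ, f (a + y * Complex.I))) := fun a ha hac =>
    intervalIntegral_tendsto_integral (hint a ha hac) tendsto_neg_atTop_atBot tendsto_id
  have h1 := ((hv c hc le_rfl).const_mul Complex.I).sub ((hv 1 le_rfl hc).const_mul Complex.I)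
  have h2 := (hhor 1 (by simp)).sub (hhor (-1) (by simp))
  simp_rw [hrect] at h1
  have h3 := tendsto_nhds_unique h1 h2
  rw [sub_zero, ← mul_sub] at h3
  exact sub_eq_zero.1 ((mul_eq_zero.1 h3).resolve_left Complex.I_ne_zero)

theorem abs_cos_mul_im_sub_sin_mul_re_le_norm (θ : ℝ) (X : ℂ) :
    |Real.cos θ * X.im - Real.sin θ * X.re| ≤ ‖X‖ := by
  rw [← Real.sqrt_sq_eq_abs, Complex.norm_def, Complex.normSq_apply]
  refine Real.sqrt_le_sqrt ?_
  nlinarith [sq_nonneg (Real.cos θ * X.re + Real.sin θ * X.im), Real.sin_sq_add_cos_sq θ,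
    sq_nonneg X.re, sq_nonneg X.im]

theorem cos_mul_im_sub_sin_mul_re (θ : ℝ) (X : ℂ) :
    Real.cos θ * X.im - Real.sin θ * X.re = ‖X‖ * Real.sin (X.arg - θ) := by
  rw [Real.sin_sub]
  linear_combination -Real.cos θ * Complex.norm_mul_sin_arg X +
    Real.sin θ * Complex.norm_mul_cos_arg X

/-- The `α`-th powers of the right half plane stay away from any ray outside of the closed sector
of half-opening `α * π / 2`. -/
theorem exists_pos_mul_le_norm_cpow_sub {α : ℝ} (hα₀ : 0 < α) (hα₁ : α < 1) {lam : ℂ}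
    (harg : α * π / 2 < |lam.arg|) :
    ∃ δ > 0, ∀ r : ℝ, 0 ≤ r → ∀ s : ℂ, 0 < s.re → δ * ‖lam * r‖ ≤ ‖s ^ (α : ℂ) - lam * r‖ := by
  have hpi := pi_pos
  have hθ : 0 < α * π / 2 := by positivity
  have hθ' : α * π / 2 < π / 2 := by nlinarith
  have hφ : ∀ s : ℂ, 0 < s.re → |s.arg * α| ≤ α * π / 2 := by
    intro s hs
    have := Complex.abs_arg_le_pi_div_two_iff.2 hs.le
    rw [abs_mul, abs_of_pos hα₀]
    nlinarith
  have hu : ∀ (θ r : ℝ) (s : ℂ),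
      |‖s‖ ^ α * Real.sin (s.arg * α - θ) - r * (‖lam‖ * Real.sin (lam.arg - θ))| ≤
        ‖s ^ (α : ℂ) - lam * r‖ := by
    intro θ r s
    refine le_of_eq_of_le (congrArg _ ?_)
      (abs_cos_mul_im_sub_sin_mul_re_le_norm θ (s ^ (α : ℂ) - lam * r))
    rw [← cos_mul_im_sub_sin_mul_re θ lam, Complex.sub_im, Complex.sub_re, Complex.im_mul_ofReal,
      Complex.re_mul_ofReal, Complex.cpow_ofReal_im, Complex.cpow_ofReal_re, Real.sin_sub]
    ring
  have hnorm : ∀ r : ℝ, 0 ≤ r → ‖lam * r‖ = r * ‖lam‖ := fun r hr => by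
    rw [norm_mul, Complex.norm_real, norm_of_nonneg hr, mul_comm]
  rcases le_or_gt 0 lam.arg with h | h
  · rw [abs_of_nonneg h] at harg
    refine ⟨Real.sin (lam.arg - α * π / 2), sin_pos_of_pos_of_lt_pi (by linarith)
      (by linarith [Complex.arg_le_pi lam]), fun r hr s hs => ?_⟩
    have h1 := abs_le.1 (hφ s hs)
    have h2 : Real.sin (s.arg * α - α * π / 2) ≤ 0 :=
      sin_nonpos_of_nonpos_of_neg_pi_le (by linarith) (by linarith)
    have h3 := mul_nonpos_of_nonneg_of_nonpos (by positivity : 0 ≤ ‖s‖ ^ α) h2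
    rw [hnorm r hr]
    linarith [hu (α * π / 2) r s, neg_abs_le
      (‖s‖ ^ α * Real.sin (s.arg * α - α * π / 2) - r * (‖lam‖ * Real.sin (lam.arg - α * π / 2)))]
  · rw [abs_of_neg h] at harg
    refine ⟨-Real.sin (lam.arg - -(α * π / 2)), neg_pos.2 (sin_neg_of_neg_of_neg_pi_lt (by linarith)
      (by linarith [Complex.neg_pi_lt_arg lam])), fun r hr s hs => ?_⟩
    have h1 := abs_le.1 (hφ s hs)
    have h2 : 0 ≤ Real.sin (s.arg * α - -(α * π / 2)) :=
      sin_nonneg_of_nonneg_of_le_pi (by linarith) (by linarith)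
    have h3 := mul_nonneg (by positivity : 0 ≤ ‖s‖ ^ α) h2
    rw [hnorm r hr]
    linarith [hu (-(α * π / 2)) r s, le_abs_self
      (‖s‖ ^ α * Real.sin (s.arg * α - -(α * π / 2)) -
        r * (‖lam‖ * Real.sin (lam.arg - -(α * π / 2))))]

theorem norm_inv_one_sub_le {q : ℂ} {δ : ℝ} (hδ : 0 < δ) (h : δ * ‖q‖ ≤ ‖1 - q‖) :
    ‖(1 - q)⁻¹‖ ≤ 1 + δ⁻¹ := by
  have h1 : 1 ≤ ‖1 - q‖ + ‖q‖ := by simpa using norm_add_le (1 - q) q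
  have h2 : ‖q‖ ≤ δ⁻¹ * ‖1 - q‖ := by rwa [← div_eq_inv_mul, le_div_iff₀' hδ]
  have h3 : 1 ≤ (1 + δ⁻¹) * ‖1 - q‖ := by linarith
  have h4 : 0 < ‖1 - q‖ := by
    by_contra! h0
    have : (1 + δ⁻¹) * ‖1 - q‖ ≤ 0 := mul_nonpos_of_nonneg_of_nonpos (by positivity) h0
    linarith
  rwa [norm_inv, inv_le_iff_one_le_mul₀ h4]

theorem norm_inv_one_sub_add_le {q : ℂ} {α δ : ℝ} (hα : 0 ≤ α) (hδ : 0 < δ)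
    (h : δ * ‖q‖ ≤ ‖1 - q‖) :
    ‖(1 - q)⁻¹ + α * (q / (1 - q) ^ 2)‖ ≤ (1 + α * δ⁻¹) * ‖(1 - q)⁻¹‖ := by
  have h2 : ‖q‖ * ‖(1 - q)⁻¹‖ ≤ δ⁻¹ := by
    rw [norm_inv, ← div_eq_mul_inv]
    refine div_le_of_le_mul₀ (norm_nonneg _) (by positivity) ?_
    rwa [← div_eq_inv_mul, le_div_iff₀' hδ]
  calc _ ≤ ‖(1 - q)⁻¹‖ + ‖α * (q / (1 - q) ^ 2)‖ := norm_add_le _ _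
    _ = ‖(1 - q)⁻¹‖ + α * (‖q‖ * ‖(1 - q)⁻¹‖) * ‖(1 - q)⁻¹‖ := by
      rw [norm_mul, Complex.norm_real, norm_of_nonneg hα, norm_div, norm_pow, norm_inv]
      ring
    _ ≤ ‖(1 - q)⁻¹‖ + α * δ⁻¹ * ‖(1 - q)⁻¹‖ := by gcongr
    _ = _ := by ring

/-- The integrand of the vertical line integral representing the Mittag-Leffler function. -/
noncomputable def mittagLefflerKernel (α : ℝ) (z s : ℂ) : ℂ :=
  Complex.exp s * s ^ (-((2 : ℝ) : ℂ)) *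
    ((1 - z * s ^ (-(α : ℂ)))⁻¹ +
      α * (z * s ^ (-(α : ℂ)) / (1 - z * s ^ (-(α : ℂ))) ^ 2))

theorem hasSum_mittagLefflerKernel {α : ℝ} {z s : ℂ} (hs : s ≠ 0)
    (h : ‖z * s ^ (-(α : ℂ))‖ < 1) :
    HasSum (fun k : ℕ => z ^ k * (α * k + 1) *
      (Complex.exp s * s ^ (-((α * k + 2 : ℝ) : ℂ)))) (mittagLefflerKernel α z s) := by
  have h1 := ((hasSum_geometric_of_norm_lt_one h).add
    ((hasSum_coe_mul_geometric_of_norm_lt_one h).mul_left (α : ℂ))).mul_left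
    (Complex.exp s * s ^ (-((2 : ℝ) : ℂ)))
  rw [mittagLefflerKernel]
  convert! h1 using 2 with k
  have : s ^ (-((α * k + 2 : ℝ) : ℂ)) = s ^ (-((2 : ℝ) : ℂ)) * (s ^ (-(α : ℂ))) ^ k := by
    rw [← Complex.cpow_mul_nat, ← Complex.cpow_add _ _ hs]
    push_cast
    ring_nf
  rw [this, mul_pow]
  ring

/-- A vertical line integral for the Mittag-Leffler function, for a line far to the right. -/
theorem mittagLeffler_eq_integral {α c : ℝ} (hα : 0 < α) (hc : 1 ≤ c) {z : ℂ}
    (hz : ‖z‖ < c ^ α) :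
    2 * π * mittagLeffler α 1 z = ∫ y : ℝ, mittagLefflerKernel α z (c + y * Complex.I) := by
  have hc0 : 0 < c := by linarith
  set F : ℕ → ℝ → ℂ := fun k y => z ^ k * (α * k + 1) * (Complex.exp (c + y * Complex.I) *
    (c + y * Complex.I : ℂ) ^ (-((α * k + 2 : ℝ) : ℂ))) with hF
  have hcn : ∀ y : ℝ, c ≤ ‖(c + y * Complex.I : ℂ)‖ := fun y => by
    refine le_trans (le_abs_self c) ?_
    simpa using Complex.abs_re_le_norm (c + y * Complex.I : ℂ)
  have hρ0 : 0 ≤ ‖z‖ * c ^ (-α) := by positivity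
  have hρ : ‖z‖ * c ^ (-α) < 1 := by
    rwa [rpow_neg hc0.le, ← div_eq_mul_inv, div_lt_one (by positivity)]
  have hFn : ∀ k y, ‖F k y‖ ≤ Real.exp c * ((α * k + 1) * (‖z‖ * c ^ (-α)) ^ k) *
      ‖(c + y * Complex.I : ℂ)‖ ^ (-2 : ℝ) := by
    intro k y
    have hk : ‖(α * k + 1 : ℂ)‖ = α * k + 1 := by
      rw [show (α * k + 1 : ℂ) = ((α * k + 1 : ℝ) : ℂ) by push_cast; rfl, Complex.norm_real,
        norm_of_nonneg (by positivity)]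
    have hpos : 0 < ‖(c + y * Complex.I : ℂ)‖ := hc0.trans_le (hcn y)
    rw [hF]
    simp only [norm_mul, norm_pow, hk, Complex.norm_exp]
    rw [← Complex.ofReal_neg, Complex.norm_cpow_real, neg_add, rpow_add hpos, mul_pow,
      ← rpow_mul_natCast hc0.le, neg_mul]
    have h1 : ‖(c + y * Complex.I : ℂ)‖ ^ (-(α * k)) ≤ c ^ (-(α * k)) :=
      rpow_le_rpow_of_nonpos hc0 (hcn y) (by simp; positivity)
    calc _ = Real.exp c * ((α * k + 1) * (‖z‖ ^ k * ‖(c + y * Complex.I : ℂ)‖ ^ (-(α * k)))) *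
          ‖(c + y * Complex.I : ℂ)‖ ^ (-2 : ℝ) := by simp; ring
      _ ≤ _ := by gcongr
  have hJ := integrable_norm_add_mul_I_rpow_neg hc one_lt_two
  have hFi : ∀ k, Integrable (F k) := fun k => by
    refine (hJ.const_mul _).mono' (Continuous.aestronglyMeasurable ?_) (Eventually.of_forall (hFn k))
    have := continuous_add_mul_I_cpow hc0 (-((α * k + 2 : ℝ) : ℂ))
    exact continuous_const.mul (Continuous.mul (by fun_prop) this)
  have hsumρ : Summable fun k : ℕ => (α * k + 1) * (‖z‖ * c ^ (-α)) ^ k := by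
    have h0 : ‖‖z‖ * c ^ (-α)‖ < 1 := by rwa [norm_of_nonneg hρ0]
    refine (((hasSum_coe_mul_geometric_of_norm_lt_one h0).summable.mul_left α).add
      (summable_geometric_of_lt_one hρ0 hρ)).congr fun k => by ring
  have hsum : Summable fun k => ∫ y, ‖F k y‖ := by
    refine Summable.of_nonneg_of_le (fun k => integral_nonneg fun y => norm_nonneg _)
      (fun k => integral_mono (hFi k).norm (hJ.const_mul _) (hFn k)) ?_
    simp_rw [integral_const_mul]
    exact (hsumρ.mul_left _).mul_right _
  have hmain := (hasSum_integral_of_summable_integral_norm hFi hsum).tsum_eq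
  have hR : ∀ y : ℝ, ∑' k, F k y = mittagLefflerKernel α z (c + y * Complex.I) := fun y => by
    have hpos : 0 < ‖(c + y * Complex.I : ℂ)‖ := hc0.trans_le (hcn y)
    refine (hasSum_mittagLefflerKernel (norm_pos_iff.1 hpos) (lt_of_le_of_lt ?_ hρ)).tsum_eq
    rw [norm_mul, ← Complex.ofReal_neg, Complex.norm_cpow_real]
    exact mul_le_mul_of_nonneg_left (rpow_le_rpow_of_nonpos hc0 (hcn y) (by linarith))
      (norm_nonneg z)
  simp_rw [hR] at hmain
  rw [← hmain, mittagLeffler, ← tsum_mul_left]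
  congr 1 with k
  have hk : 0 < α * k + 1 := by positivity
  have hkC : (α * k + 1 : ℂ) ≠ 0 := by exact_mod_cast hk.ne'
  have hG : Complex.Gamma (α * k + 1) ≠ 0 := by
    refine Complex.Gamma_ne_zero_of_re_pos ?_
    simpa using hk
  rw [hF]
  simp only
  rw [integral_const_mul, integral_cexp_mul_cpow_neg_vertical hc (by linarith)]
  push_cast
  rw [show (α * k + 2 : ℂ) = (α * k + 1) + 1 by ring, Complex.Gamma_add_one _ hkC]
  field_simp

theorem norm_mittagLefflerKernel_le {α δ : ℝ} (hα : 0 ≤ α) (hδ : 0 < δ) {z s : ℂ}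
    (h : δ * ‖z * s ^ (-(α : ℂ))‖ ≤ ‖1 - z * s ^ (-(α : ℂ))‖) :
    ‖mittagLefflerKernel α z s‖ ≤ Real.exp s.re * ‖s‖ ^ (-2 : ℝ) *
      ((1 + α * δ⁻¹) * ‖(1 - z * s ^ (-(α : ℂ)))⁻¹‖) := by
  rw [mittagLefflerKernel, norm_mul, norm_mul, Complex.norm_exp, ← Complex.ofReal_neg,
    Complex.norm_cpow_real]
  gcongr
  simpa using norm_inv_one_sub_add_le hα hδ h

theorem differentiableOn_mittagLefflerKernel {α : ℝ} {z : ℂ}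
    (h : ∀ s : ℂ, 0 < s.re → 1 - z * s ^ (-(α : ℂ)) ≠ 0) :
    DifferentiableOn ℂ (mittagLefflerKernel α z) {s | 0 < s.re} := by
  intro s hs
  have hsl : s ∈ Complex.slitPlane := Or.inl hs
  have hp : ∀ a : ℂ, DifferentiableAt ℂ (fun s : ℂ => s ^ a) s := fun a =>
    differentiableAt_id.cpow_const hsl
  have hq : DifferentiableAt ℂ (fun s : ℂ => z * s ^ (-(α : ℂ))) s := (hp _).const_mul z
  have h1 : DifferentiableAt ℂ (fun s : ℂ => 1 - z * s ^ (-(α : ℂ))) s :=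
    (differentiableAt_const _).sub hq
  refine DifferentiableAt.differentiableWithinAt ?_
  unfold mittagLefflerKernel
  exact (Complex.differentiable_exp.differentiableAt.mul (hp _)).mul
    ((h1.inv (h s hs)).add ((hq.div (h1.pow 2) (pow_ne_zero 2 (h s hs))).const_mul _))

/-- For `0 < α < 1` and nonzero `λ ∈ ℂ` with `|arg λ| > απ/2`,
`E_α(λ t^α) = O(t^{−α})` as `t → ∞`; in particular `E_α(λ t^α) → 0`. -/
theorem mittagLeffler_stable_decay (α : ℝ) (hα₀ : 0 < α) (hα₁ : α < 1)
    (lam : ℂ) (hlam : lam ≠ 0) (harg : α * π / 2 < |Complex.arg lam|) :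
    (fun t : ℝ => mittagLeffler α 1 (lam * ((t ^ α : ℝ) : ℂ))) =O[atTop]
        (fun t : ℝ => t ^ (-α)) ∧
      Tendsto (fun t : ℝ => mittagLeffler α 1 (lam * ((t ^ α : ℝ) : ℂ))) atTop
        (nhds 0) := by
  obtain ⟨δ, hδ, hsep⟩ := exists_pos_mul_le_norm_cpow_sub hα₀ hα₁ harg
  have hq : ∀ r : ℝ, 0 ≤ r → ∀ s : ℂ, 0 < s.re →
      δ * ‖lam * r * s ^ (-(α : ℂ))‖ ≤ ‖1 - lam * r * s ^ (-(α : ℂ))‖ := by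
    intro r hr s hs
    have hs0 : s ≠ 0 := fun h => by simp [h] at hs
    have hw : s ^ (α : ℂ) ≠ 0 := by simp [Complex.cpow_eq_zero_iff, hs0]
    have : 1 - lam * r * s ^ (-(α : ℂ)) = (s ^ (α : ℂ) - lam * r) * s ^ (-(α : ℂ)) := by
      rw [Complex.cpow_neg, sub_mul, mul_inv_cancel₀ hw]
    rw [this, norm_mul, norm_mul _ (s ^ (-(α : ℂ))), ← mul_assoc]
    exact mul_le_mul_of_nonneg_right (hsep r hr s hs) (norm_nonneg _)
  set A : ℝ := Real.exp 1 * (1 + α * δ⁻¹) * (δ * ‖lam‖)⁻¹ with hA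
  set J : ℝ := ∫ y : ℝ, ‖((1 : ℝ) + y * Complex.I : ℂ)‖ ^ (-(2 - α)) with hJ
  have hbound : ∀ r : ℝ, 0 < r → ‖mittagLeffler α 1 (lam * r)‖ ≤ A * J / (2 * π) * r⁻¹ := by
    intro r hr
    have hq := hq r hr.le
    obtain ⟨c, hc1, hc⟩ : ∃ c : ℝ, 1 ≤ c ∧ ‖lam * r‖ < c ^ α :=
      ((eventually_ge_atTop 1).and
        ((tendsto_rpow_atTop hα₀).eventually_gt_atTop ‖lam * r‖)).exists
    have hne : ∀ s : ℂ, 0 < s.re → 1 - lam * r * s ^ (-(α : ℂ)) ≠ 0 := by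
      intro s hs h0
      have h1 := hq s hs
      rw [h0, norm_zero, ← sub_eq_zero.1 h0, norm_one] at h1
      linarith
    have hshift := integral_vertical_eq_of_norm_le (f := mittagLefflerKernel α (lam * r))
      (C := Real.exp c * ((1 + α * δ⁻¹) * (1 + δ⁻¹))) hc1 one_lt_two
      (differentiableOn_mittagLefflerKernel hne) fun s hs1 hsc => by
        refine (norm_mittagLefflerKernel_le hα₀.le hδ (hq s (by linarith))).trans ?_
        rw [mul_right_comm]
        gcongr
        exact norm_inv_one_sub_le hδ (hq s (by linarith))
    have hE := (mittagLeffler_eq_integral hα₀ hc1 hc).trans hshift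
    have hint : ‖∫ y : ℝ, mittagLefflerKernel α (lam * r) ((1 : ℝ) + y * Complex.I)‖ ≤
        ∫ y : ℝ, A * r⁻¹ * ‖((1 : ℝ) + y * Complex.I : ℂ)‖ ^ (-(2 - α)) := by
      refine norm_integral_le_of_norm_le
        ((integrable_norm_add_mul_I_rpow_neg le_rfl (by linarith)).const_mul _)
        (Eventually.of_forall fun y => ?_)
      set s : ℂ := (1 : ℝ) + y * Complex.I with hs
      have hre : s.re = 1 := by simp [hs]
      have hs0 : 0 < s.re := by rw [hre]; exact one_pos
      have hsn : 0 < ‖s‖ := norm_pos_iff.2 fun h => by simp [h] at hs0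
      have hqn : ‖lam * r * s ^ (-(α : ℂ))‖ = ‖lam‖ * r * ‖s‖ ^ (-α) := by
        rw [norm_mul, norm_mul, Complex.norm_real, norm_of_nonneg hr.le, ← Complex.ofReal_neg,
          Complex.norm_cpow_real]
      have hl : 0 < ‖lam‖ := norm_pos_iff.2 hlam
      have h1 : ‖(1 - lam * r * s ^ (-(α : ℂ)))⁻¹‖ ≤ (δ * ‖lam‖)⁻¹ * r⁻¹ * ‖s‖ ^ α := by
        have h2 := hq s hs0
        rw [hqn] at h2
        rw [norm_inv]
        refine (inv_anti₀ (by positivity) h2).trans_eq ?_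
        rw [rpow_neg hsn.le]
        field_simp
      refine (norm_mittagLefflerKernel_le hα₀.le hδ (hq s hs0)).trans ?_
      rw [hre]
      calc _ ≤ Real.exp 1 * ‖s‖ ^ (-2 : ℝ) *
            ((1 + α * δ⁻¹) * ((δ * ‖lam‖)⁻¹ * r⁻¹ * ‖s‖ ^ α)) := by gcongr
        _ = _ := by
          rw [show -(2 - α) = -2 + α by ring, rpow_add hsn, hA]
          ring
    rw [← hE, integral_const_mul, ← hJ, norm_mul] at hint
    have h2pi : ‖(2 * π : ℂ)‖ = 2 * π := by
      simp [abs_of_pos pi_pos]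
    rw [h2pi] at hint
    rw [div_mul_eq_mul_div, le_div_iff₀' (by positivity)]
    linarith
  have hO : (fun t : ℝ => mittagLeffler α 1 (lam * ((t ^ α : ℝ) : ℂ))) =O[atTop]
      (fun t : ℝ => t ^ (-α)) := by
    refine IsBigO.of_bound (A * J / (2 * π)) ?_
    filter_upwards [eventually_gt_atTop 0] with t ht
    rw [norm_of_nonneg (by positivity : 0 ≤ t ^ (-α)), rpow_neg ht.le]
    exact hbound _ (by positivity)
  exact ⟨hO, hO.trans_tendsto (tendsto_rpow_neg_atTop hα₀)⟩
end

section
/- Let 0 < α < 1 and let λ ∈ ℂ be nonzero with |arg(λ)| > απ/2. Then t^{α−1} E_{α,α}(λ t^α) = O(t^{−1−α}) as t → ∞; in particular t^{α−1} E_{α,α}(λ t^α) → 0 as t → ∞. -/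
open Filter Asymptotics Real

namespace MittagLeffler

open MeasureTheory Set Topology

open Complex (I)

/-- The integral of `f` along the contour coming in from `+∞` on the line `Im w = -θ`, going up
the vertical line `Re w = L`, and leaving to `+∞` on the line `Im w = θ`. Under `s = exp w` this
is a Hankel contour in the `s`-plane. -/
noncomputable def hankelIntegral (θ L : ℝ) (f : ℂ → ℂ) : ℂ :=
  (∫ u in Ioi L, f (u + θ * I)) - (∫ u in Ioi L, f (u + (-θ : ℝ) * I)) +
    I * ∫ y in (-θ)..θ, f (L + y * I)

/-- The integrand `exp (s) s ^ b`, up to the Jacobian, in the coordinate `s = exp w`. -/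
noncomputable def hankelKernel (b : ℝ) (w : ℂ) : ℂ := Complex.exp (Complex.exp w + b * w)

/-- The norm of `hankelKernel b` on a horizontal line where `cos (Im w) = c`. -/
noncomputable def kernelBound (c b u : ℝ) : ℝ := rexp (c * rexp u + b * u)

lemma norm_hankelKernel (b u y : ℝ) :
    ‖hankelKernel b (u + y * I)‖ = kernelBound (cos y) b u := by
  simp [hankelKernel, kernelBound, Complex.norm_exp, Complex.exp_re, mul_comm]

lemma continuous_kernelBound (c b : ℝ) : Continuous (kernelBound c b) := by
  unfold kernelBound; fun_prop

lemma kernelBound_pos (c b u : ℝ) : 0 < kernelBound c b u := exp_pos _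

lemma differentiable_hankelKernel (b : ℝ) : Differentiable ℂ (hankelKernel b) := by
  unfold hankelKernel; fun_prop

lemma continuous_hankelKernel (b : ℝ) : Continuous (hankelKernel b) :=
  (differentiable_hankelKernel b).continuous

lemma tendsto_mul_exp_add_mul_atTop {c : ℝ} (hc : c < 0) (b : ℝ) :
    Tendsto (fun u : ℝ => c * rexp u + b * u) atTop atBot := by
  have h : Tendsto (fun u : ℝ => u * (c * (rexp u / u ^ 1) + b)) atTop atBot := by
    apply tendsto_id.atTop_mul_atBot₀
    exact tendsto_atBot_add_const_right _ _
      ((tendsto_exp_div_pow_atTop 1).const_mul_atTop_of_neg hc)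
  refine h.congr' ?_
  filter_upwards [eventually_gt_atTop 0] with u hu
  field_simp

lemma tendsto_kernelBound_atTop {c : ℝ} (hc : c < 0) (b : ℝ) :
    Tendsto (kernelBound c b) atTop (𝓝 0) :=
  tendsto_exp_atBot.comp (tendsto_mul_exp_add_mul_atTop hc b)

lemma tendsto_kernelBound_atBot {c : ℝ} (hc : c < 0) {b : ℝ} (hb : 0 < b) :
    Tendsto (kernelBound c b) atBot (𝓝 0) := by
  refine tendsto_exp_atBot.comp ?_
  refine tendsto_atBot_mono (fun u => ?_) (tendsto_id.const_mul_atBot hb)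
  have := exp_pos u
  simp only [id]
  nlinarith

lemma integrableOn_kernelBound_Ioi {c : ℝ} (hc : c < 0) (b L : ℝ) :
    IntegrableOn (kernelBound c b) (Ioi L) := by
  refine integrable_of_isBigO_exp_neg one_pos (continuous_kernelBound c b).continuousOn ?_
  refine IsBigO.of_bound 1 ?_
  filter_upwards [(tendsto_mul_exp_add_mul_atTop hc (b + 1)).eventually_le_atBot 0] with u hu
  rw [kernelBound, norm_of_nonneg (exp_pos _).le, norm_of_nonneg (exp_pos _).le, one_mul,
    exp_le_exp]
  linarith

lemma integrable_kernelBound {c : ℝ} (hc : c < 0) {b : ℝ} (hb : 0 < b) :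
    Integrable (kernelBound c b) := by
  rw [← integrableOn_univ, ← Iic_union_Ioi (a := (0 : ℝ))]
  refine IntegrableOn.union ?_ (integrableOn_kernelBound_Ioi hc b 0)
  refine (integrableOn_exp_mul_Iic hb 0).mono' (continuous_kernelBound c b).aestronglyMeasurable ?_
  refine ae_of_all _ fun u => ?_
  rw [kernelBound, norm_of_nonneg (exp_pos _).le, exp_le_exp]
  have := exp_pos u
  nlinarith

lemma integrableOn_hankelKernel_Ioi {y : ℝ} (hy : cos y < 0) (b L : ℝ) :
    IntegrableOn (fun u : ℝ => hankelKernel b (u + y * I)) (Ioi L) := by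
  refine (integrableOn_kernelBound_Ioi hy b L).mono' ?_ ?_
  · exact ((continuous_hankelKernel b).comp (by fun_prop)).aestronglyMeasurable
  · exact ae_of_all _ fun u => (norm_hankelKernel b u y).le

lemma integrable_hankelKernel {y : ℝ} (hy : cos y < 0) {b : ℝ} (hb : 0 < b) :
    Integrable (fun u : ℝ => hankelKernel b (u + y * I)) := by
  refine (integrable_kernelBound hy hb).mono' ?_ ?_
  · exact ((continuous_hankelKernel b).comp (by fun_prop)).aestronglyMeasurable
  · exact ae_of_all _ fun u => (norm_hankelKernel b u y).le

/-- The Hankel contour integral does not depend on the position of its vertical part. -/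
lemma hankelIntegral_shift {θ L M : ℝ} (hθ : 0 ≤ θ) {f : ℂ → ℂ}
    (hf : ∀ w : ℂ, |w.im| ≤ θ → DifferentiableAt ℂ f w)
    (h₁ : ∀ L, IntegrableOn (fun u : ℝ => f (u + θ * I)) (Ioi L))
    (h₂ : ∀ L, IntegrableOn (fun u : ℝ => f (u + (-θ : ℝ) * I)) (Ioi L)) :
    hankelIntegral θ L f = hankelIntegral θ M f := by
  have key := Complex.integral_boundary_rect_eq_zero_of_differentiableOn f
    (L + (-θ : ℝ) * I) (M + θ * I) (by
      intro w hw
      refine (hf w ?_).differentiableWithinAt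
      have := hw.2
      simp only [Complex.add_im, Complex.ofReal_im, Complex.mul_im, Complex.ofReal_re, Complex.I_im,
        Complex.I_re, mul_one, mul_zero, add_zero, zero_add, mem_preimage] at this
      rw [uIcc_of_le (by linarith)] at this
      exact abs_le.2 this)
  simp only [Complex.add_im, Complex.add_re, Complex.mul_re, Complex.ofReal_im, Complex.mul_im,
    Complex.ofReal_re, Complex.I_im, Complex.I_re, mul_one, mul_zero, add_zero, zero_add,
    smul_eq_mul, sub_self] at key
  rw [← intervalIntegral.integral_Ioi_sub_Ioi' (h₁ L) (h₁ M),
    ← intervalIntegral.integral_Ioi_sub_Ioi' (h₂ L) (h₂ M)] at key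
  unfold hankelIntegral
  linear_combination -key

/-- The Hankel contour integral of a derivative vanishes. -/
lemma hankelIntegral_deriv {θ L : ℝ} {f f' : ℂ → ℂ} (hf : ∀ w, HasDerivAt f (f' w) w)
    (hf' : Continuous f')
    (h₁ : IntegrableOn (fun u : ℝ => f' (u + θ * I)) (Ioi L))
    (h₂ : IntegrableOn (fun u : ℝ => f' (u + (-θ : ℝ) * I)) (Ioi L))
    (t₁ : Tendsto (fun u : ℝ => f (u + θ * I)) atTop (𝓝 0))
    (t₂ : Tendsto (fun u : ℝ => f (u + (-θ : ℝ) * I)) atTop (𝓝 0)) :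
    hankelIntegral θ L f' = 0 := by
  have hor (y u : ℝ) : HasDerivAt (fun u : ℝ => f (u + y * I)) (f' (u + y * I)) u := by
    have h := (((hasDerivAt_id (u : ℂ)).add_const (y * I)).comp_ofReal)
    have h' := (hf (u + y * I)).comp u h
    rw [mul_one] at h'
    exact h'
  have ver (y : ℝ) : HasDerivAt (fun y : ℝ => f (L + y * I)) (I * f' (L + y * I)) y := by
    have h := ((((hasDerivAt_id (y : ℂ)).mul_const I).const_add (L : ℂ)).comp_ofReal)
    have h' := (hf (L + y * I)).comp y h
    rw [one_mul, mul_comm] at h'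
    exact h'
  have e₁ := integral_Ioi_of_hasDerivAt_of_tendsto' (fun u _ => hor θ u) h₁ t₁
  have e₂ := integral_Ioi_of_hasDerivAt_of_tendsto' (fun u _ => hor (-θ) u) h₂ t₂
  have e₃ := intervalIntegral.integral_eq_sub_of_hasDerivAt (a := -θ) (b := θ) (fun y _ => ver y)
    (Continuous.intervalIntegrable (by fun_prop) _ _)
  rw [intervalIntegral.integral_const_mul] at e₃
  rw [hankelIntegral, e₁, e₂, e₃]
  ring

lemma cos_le_cos_of_abs_mem {θ y : ℝ} (hθ : 0 ≤ θ) (h₁ : θ ≤ |y|) (h₂ : |y| ≤ π) :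
    cos y ≤ cos θ := by
  rw [← cos_abs y]
  exact cos_le_cos_of_nonneg_of_le_pi hθ h₂ h₁

lemma kernelBound_mono {c d : ℝ} (h : c ≤ d) (b u : ℝ) :
    kernelBound c b u ≤ kernelBound d b u := by
  unfold kernelBound
  gcongr

lemma tendsto_intervalIntegral_zero {l : Filter ℝ} {f : ℂ → ℂ} {a b : ℝ} {B : ℝ → ℝ}
    (hB : Tendsto B l (𝓝 0)) (h : ∀ x : ℝ, ∀ y ∈ uIcc a b, ‖f (x + y * I)‖ ≤ B x) :
    Tendsto (fun x : ℝ => ∫ y in a..b, f (x + y * I)) l (𝓝 0) := by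
  refine squeeze_zero_norm (a := fun x => B x * |b - a|) (fun x => ?_) (by simpa using hB.mul_const _)
  exact intervalIntegral.norm_integral_le_of_norm_le_const
    fun y hy => h x y (uIoc_subset_uIcc hy)

/-- Horizontal lines can be moved when the integrand decays at both ends of the strip. -/
lemma integral_horizontal_eq {a b : ℝ} {f : ℂ → ℂ} (hf : Differentiable ℂ f) {B : ℝ → ℝ}
    (hbot : Tendsto B atBot (𝓝 0)) (htop : Tendsto B atTop (𝓝 0))
    (h : ∀ x : ℝ, ∀ y ∈ uIcc a b, ‖f (x + y * I)‖ ≤ B x)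
    (ha : Integrable fun u : ℝ => f (u + a * I)) (hb : Integrable fun u : ℝ => f (u + b * I)) :
    ∫ u : ℝ, f (u + a * I) = ∫ u : ℝ, f (u + b * I) := by
  have key (T : ℝ) := Complex.integral_boundary_rect_eq_zero_of_differentiableOn f
    ((-T : ℝ) + a * I) (T + b * I) hf.differentiableOn
  simp only [Complex.add_im, Complex.add_re, Complex.mul_re, Complex.ofReal_im, Complex.mul_im,
    Complex.ofReal_re, Complex.I_im, Complex.I_re, mul_one, mul_zero, add_zero, zero_add,
    smul_eq_mul, sub_self] at key
  have t₁ := intervalIntegral_tendsto_integral ha tendsto_neg_atTop_atBot tendsto_id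
  have t₂ := intervalIntegral_tendsto_integral hb tendsto_neg_atTop_atBot tendsto_id
  have t₃ := (tendsto_intervalIntegral_zero htop h).const_mul I
  have t₄ := ((tendsto_intervalIntegral_zero hbot h).comp tendsto_neg_atTop_atBot).const_mul I
  have t := ((t₁.sub t₂).add t₃).sub t₄
  have := tendsto_nhds_unique (t.congr key) tendsto_const_nhds
  simpa [sub_eq_zero] using this

lemma integral_hankelKernel_pi {a : ℝ} (ha : 0 < a) :
    ∫ u : ℝ, hankelKernel a (u + π * I) = Complex.exp (a * π * I) * Complex.Gamma a := by
  have h := integral_image_eq_integral_abs_deriv_smul (s := univ) MeasurableSet.univ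
    (fun x _ => (Real.hasDerivAt_exp x).hasDerivWithinAt) exp_injective.injOn
    (fun r => rexp (-r) * r ^ (a - 1))
  rw [image_univ, range_exp, ← Gamma_eq_integral ha, Measure.restrict_univ] at h
  rw [Complex.Gamma_ofReal, h, ← integral_complex_ofReal, ← integral_const_mul]
  congr 1 with u
  have e : Complex.exp (u + π * I) = -(rexp u : ℂ) := by
    rw [Complex.exp_add, Complex.exp_pi_mul_I]; simp
  rw [hankelKernel, e, ← exp_mul, abs_of_pos (exp_pos u), smul_eq_mul, ← exp_add, ← exp_add]
  push_cast
  rw [← Complex.exp_add]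
  congr 1
  ring

lemma integral_hankelKernel {θ a : ℝ} (hθ₁ : π / 2 < θ) (hθ₂ : θ < π) (ha : 0 < a) :
    ∫ u : ℝ, hankelKernel a (u + θ * I) = Complex.exp (a * π * I) * Complex.Gamma a := by
  have hc : cos θ < 0 := cos_neg_of_pi_div_two_lt_of_lt hθ₁ (by linarith)
  rw [← integral_hankelKernel_pi ha]
  refine integral_horizontal_eq (differentiable_hankelKernel a) (tendsto_kernelBound_atBot hc ha)
    (tendsto_kernelBound_atTop hc a) (fun x y hy => ?_) (integrable_hankelKernel hc ha)
    (integrable_hankelKernel (by simp) ha)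
  rw [uIcc_of_le hθ₂.le] at hy
  have : 0 < y := by linarith [hy.1, pi_pos]
  rw [norm_hankelKernel]
  exact kernelBound_mono
    (cos_le_cos_of_abs_mem (by linarith) (by rw [abs_of_pos this]; exact hy.1)
      (by rw [abs_of_pos this]; exact hy.2)) _ _

lemma integral_hankelKernel_neg {θ a : ℝ} (hθ₁ : π / 2 < θ) (hθ₂ : θ < π) (ha : 0 < a) :
    ∫ u : ℝ, hankelKernel a (u + (-θ : ℝ) * I) =
      Complex.exp (-(a * π * I)) * Complex.Gamma a := by
  have h := congrArg (starRingEnd ℂ) (integral_hankelKernel hθ₁ hθ₂ ha)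
  rw [← integral_conj] at h
  simpa [hankelKernel, ← Complex.exp_conj, ← Complex.Gamma_conj] using h

lemma tendsto_hankelIntegral_atBot {θ : ℝ} {f : ℂ → ℂ} (hθ : 0 ≤ θ) {B : ℝ → ℝ}
    (hbot : Tendsto B atBot (𝓝 0)) (h : ∀ x y : ℝ, |y| ≤ θ → ‖f (x + y * I)‖ ≤ B x)
    (h₁ : Integrable fun u : ℝ => f (u + θ * I))
    (h₂ : Integrable fun u : ℝ => f (u + (-θ : ℝ) * I)) :
    Tendsto (fun L => hankelIntegral θ L f) atBot
      (𝓝 ((∫ u : ℝ, f (u + θ * I)) - ∫ u : ℝ, f (u + (-θ : ℝ) * I))) := by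
  have c := aecover_Ioi (μ := volume) (tendsto_id (α := ℝ) (x := atBot))
  have t₁ := c.integral_tendsto_of_countably_generated h₁
  have t₂ := c.integral_tendsto_of_countably_generated h₂
  have t₃ := (tendsto_intervalIntegral_zero (f := f) (a := -θ) (b := θ) hbot
    (fun x y hy => h x y (by
    rw [uIcc_of_le (by linarith)] at hy
    exact abs_le.2 hy))).const_mul I
  rw [mul_zero] at t₃
  have t := (t₁.sub t₂).add t₃
  rw [add_zero] at t
  exact t

/-- The integral `∫ e^s s^{-x} ds` along a Hankel contour. -/
noncomputable def hankelGamma (θ x : ℝ) : ℂ := hankelIntegral θ 0 (hankelKernel (1 - x))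

lemma hankelIntegral_kernel_shift {θ : ℝ} (hθ : 0 ≤ θ) (hc : cos θ < 0) (b L M : ℝ) :
    hankelIntegral θ L (hankelKernel b) = hankelIntegral θ M (hankelKernel b) :=
  hankelIntegral_shift hθ (fun w _ => differentiable_hankelKernel b w)
    (integrableOn_hankelKernel_Ioi hc b) (integrableOn_hankelKernel_Ioi (by rwa [cos_neg]) b)

lemma hankelGamma_of_lt_one {θ x : ℝ} (hθ₁ : π / 2 < θ) (hθ₂ : θ < π) (hx₀ : 0 < x) (hx : x < 1) :
    hankelGamma θ x = 2 * π * I / Complex.Gamma x := by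
  have hc : cos θ < 0 := cos_neg_of_pi_div_two_lt_of_lt hθ₁ (by linarith)
  have hx' : 0 < 1 - x := by linarith
  have hθ : 0 ≤ θ := by linarith [pi_pos]
  have hB : Tendsto (kernelBound 1 (1 - x)) atBot (𝓝 0) := by
    have : Tendsto (fun u : ℝ => 1 * rexp u + (1 - x) * u) atBot atBot :=
      (tendsto_exp_atBot.const_mul 1).add_atBot (tendsto_id.const_mul_atBot hx')
    exact tendsto_exp_atBot.comp this
  have t := tendsto_hankelIntegral_atBot (f := hankelKernel (1 - x)) hθ hB (fun u y _ => by
      rw [norm_hankelKernel]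
      exact kernelBound_mono (cos_le_one y) _ _)
    (integrable_hankelKernel hc hx') (integrable_hankelKernel (by rwa [cos_neg]) hx')
  have e : hankelGamma θ x = _ := tendsto_nhds_unique (tendsto_const_nhds.congr
    fun L => hankelIntegral_kernel_shift hθ hc (1 - x) 0 L) t
  rw [e, integral_hankelKernel hθ₁ hθ₂ hx', integral_hankelKernel_neg hθ₁ hθ₂ hx', ← sub_mul]
  have hs : Complex.sin (π * x) ≠ 0 := by
    rw [← Complex.ofReal_mul, ← Complex.ofReal_sin, Complex.ofReal_ne_zero]
    exact (sin_pos_of_pos_of_lt_pi (by positivity) (by nlinarith [pi_pos])).ne'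
  have hΓ : Complex.Gamma x ≠ 0 := Complex.Gamma_ne_zero_of_re_pos (by simpa using hx₀)
  have hr := Complex.Gamma_mul_Gamma_one_sub x
  have hsin : Complex.exp (((1 - x : ℝ) : ℂ) * π * I) - Complex.exp (-(((1 - x : ℝ) : ℂ) * π * I)) =
      2 * I * Complex.sin (π * x) := by
    have : Complex.sin (π * x) = Complex.sin (((1 - x : ℝ) : ℂ) * π) := by
      rw [← Complex.sin_pi_sub]; congr 1; push_cast; ring
    rw [this, Complex.sin, neg_mul]
    linear_combination (Complex.exp (((1 - x : ℝ) : ℂ) * π * I) -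
      Complex.exp (-(((1 - x : ℝ) : ℂ) * π * I))) * Complex.I_sq
  rw [hsin, eq_div_iff hΓ]
  rw [eq_div_iff hs] at hr
  push_cast
  linear_combination 2 * I * hr

/-- Integrability along the three pieces of the Hankel contour. -/
structure HankelIntegrable (θ L : ℝ) (f : ℂ → ℂ) : Prop where
  upper : IntegrableOn (fun u : ℝ => f (u + θ * I)) (Ioi L)
  lower : IntegrableOn (fun u : ℝ => f (u + (-θ : ℝ) * I)) (Ioi L)
  vertical : IntervalIntegrable (fun y : ℝ => f (L + y * I)) volume (-θ) θ

lemma HankelIntegrable.const_mul {θ L : ℝ} {f : ℂ → ℂ} (hf : HankelIntegrable θ L f) (c : ℂ) :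
    HankelIntegrable θ L (fun w => c * f w) :=
  ⟨hf.upper.const_mul c, hf.lower.const_mul c, hf.vertical.const_mul c⟩

lemma hankelIntegral_add {θ L : ℝ} {f g : ℂ → ℂ} (hf : HankelIntegrable θ L f)
    (hg : HankelIntegrable θ L g) :
    hankelIntegral θ L (fun w => f w + g w) = hankelIntegral θ L f + hankelIntegral θ L g := by
  simp only [hankelIntegral]
  rw [integral_add hf.upper hg.upper, integral_add hf.lower hg.lower,
    intervalIntegral.integral_add hf.vertical hg.vertical]
  ring

lemma hankelIntegral_const_mul (θ L : ℝ) (c : ℂ) (f : ℂ → ℂ) :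
    hankelIntegral θ L (fun w => c * f w) = c * hankelIntegral θ L f := by
  simp only [hankelIntegral, integral_const_mul, intervalIntegral.integral_const_mul]
  ring

lemma hankelIntegrable_kernel {θ : ℝ} (hc : cos θ < 0) (b L : ℝ) :
    HankelIntegrable θ L (hankelKernel b) :=
  ⟨integrableOn_hankelKernel_Ioi hc b L, integrableOn_hankelKernel_Ioi (by rwa [cos_neg]) b L,
    ((continuous_hankelKernel b).comp (by fun_prop)).intervalIntegrable _ _⟩

lemma tendsto_hankelKernel_atTop {y : ℝ} (hy : cos y < 0) (b : ℝ) :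
    Tendsto (fun u : ℝ => hankelKernel b (u + y * I)) atTop (𝓝 0) :=
  squeeze_zero_norm (fun u => (norm_hankelKernel b u y).le) (tendsto_kernelBound_atTop hy b)

lemma hasDerivAt_hankelKernel (b : ℝ) (w : ℂ) :
    HasDerivAt (hankelKernel b) (hankelKernel (b + 1) w + b * hankelKernel b w) w := by
  have h := ((Complex.hasDerivAt_exp w).add ((hasDerivAt_id w).const_mul (b : ℂ))).cexp
  convert! h using 1
  simp only [hankelKernel]
  rw [show Complex.exp w + ((b + 1 : ℝ) : ℂ) * w = (Complex.exp w + b * w) + w by push_cast; ring,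
    Complex.exp_add _ w]
  simp only [Pi.add_apply, id]
  ring

lemma hankelIntegral_kernel_add_one {θ : ℝ} (hc : cos θ < 0) (b L : ℝ) :
    hankelIntegral θ L (hankelKernel (b + 1)) = -b * hankelIntegral θ L (hankelKernel b) := by
  have i₁ := hankelIntegrable_kernel hc (b + 1) L
  have i₂ := (hankelIntegrable_kernel hc b L).const_mul b
  have h := hankelIntegral_deriv (θ := θ) (L := L) (hasDerivAt_hankelKernel b)
    ((continuous_hankelKernel _).add (continuous_const.mul (continuous_hankelKernel b)))
    (i₁.upper.add i₂.upper) (i₁.lower.add i₂.lower) (tendsto_hankelKernel_atTop hc b)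
    (tendsto_hankelKernel_atTop (by rwa [cos_neg]) b)
  rw [hankelIntegral_add i₁ i₂, hankelIntegral_const_mul] at h
  linear_combination h

lemma hankelGamma_eq_mul {θ : ℝ} (hc : cos θ < 0) (x : ℝ) :
    hankelGamma θ x = x * hankelGamma θ (x + 1) := by
  have := hankelIntegral_kernel_add_one hc (-x) 0
  rw [hankelGamma, hankelGamma, show 1 - (x + 1) = -x by ring, show 1 - x = -x + 1 by ring, this]
  push_cast
  ring

lemma continuous_integral_hankelKernel {y : ℝ} (hy : cos y < 0) :
    Continuous fun b : ℝ => ∫ u in Ioi (0 : ℝ), hankelKernel b (u + y * I) := by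
  refine continuous_iff_continuousAt.2 fun b₀ => ?_
  refine continuousAt_of_dominated (bound := kernelBound (cos y) (b₀ + 1)) ?_ ?_
    (integrableOn_kernelBound_Ioi hy _ _) ?_
  · exact Eventually.of_forall fun b =>
      ((continuous_hankelKernel b).comp (by fun_prop)).aestronglyMeasurable
  · filter_upwards [eventually_le_nhds (lt_add_one b₀)] with b hb
    filter_upwards [ae_restrict_mem measurableSet_Ioi] with u hu
    rw [norm_hankelKernel, kernelBound, kernelBound]
    have : 0 ≤ u := le_of_lt hu
    gcongr
  · refine ae_of_all _ fun u => ?_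
    unfold hankelKernel
    fun_prop

lemma continuous_hankelGamma {θ : ℝ} (hc : cos θ < 0) : Continuous (hankelGamma θ) := by
  have h₁ := continuous_integral_hankelKernel hc
  have h₂ := continuous_integral_hankelKernel (y := -θ) (by rwa [cos_neg])
  have h₃ : Continuous fun b : ℝ => ∫ y in (-θ)..θ, hankelKernel b ((0 : ℝ) + y * I) := by
    apply intervalIntegral.continuous_parametric_intervalIntegral_of_continuous'
    unfold hankelKernel Function.uncurry
    fun_prop
  have h := ((h₁.sub h₂).add (continuous_const.mul h₃ (f := fun _ => I))).comp
    (continuous_const.sub continuous_id : Continuous fun x : ℝ => 1 - x)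
  exact h

/-- Hankel's formula for the reciprocal Gamma function. -/
theorem hankelGamma_eq {θ x : ℝ} (hθ₁ : π / 2 < θ) (hθ₂ : θ < π) (hx : 0 < x) :
    hankelGamma θ x = 2 * π * I / Complex.Gamma x := by
  have hc : cos θ < 0 := cos_neg_of_pi_div_two_lt_of_lt hθ₁ (by linarith)
  have base : ∀ x : ℝ, 0 < x → x ≤ 1 → hankelGamma θ x = 2 * π * I / Complex.Gamma x := by
    intro x hx₀ hx₁
    rcases hx₁.lt_or_eq with h | rfl
    · exact hankelGamma_of_lt_one hθ₁ hθ₂ hx₀ h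
    have t₁ : Tendsto (hankelGamma θ) (𝓝[<] 1) (𝓝 (hankelGamma θ 1)) :=
      (continuous_hankelGamma hc).continuousAt.tendsto.mono_left nhdsWithin_le_nhds
    have t₂ : Tendsto (fun x : ℝ => 2 * π * I * (Complex.Gamma x)⁻¹) (𝓝[<] 1)
        (𝓝 (2 * π * I * (Complex.Gamma (1 : ℝ))⁻¹)) := by
      have : Continuous fun x : ℝ => 2 * π * I * (Complex.Gamma x)⁻¹ :=
        continuous_const.mul
          (Complex.differentiable_one_div_Gamma.continuous.comp Complex.continuous_ofReal)
      exact this.continuousAt.tendsto.mono_left nhdsWithin_le_nhds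
    refine tendsto_nhds_unique t₁ (t₂.congr' ?_)
    filter_upwards [Ioo_mem_nhdsLT (zero_lt_one (α := ℝ))] with y hy
    rw [hankelGamma_of_lt_one hθ₁ hθ₂ hy.1 hy.2, div_eq_mul_inv]
  have step : ∀ n : ℕ, ∀ x : ℝ, 0 < x → x ≤ n + 1 →
      hankelGamma θ x = 2 * π * I / Complex.Gamma x := by
    intro n
    induction n with
    | zero => simpa using base
    | succ n ih =>
      intro x hx₀ hx
      rcases le_or_gt x 1 with h | h
      · exact base x hx₀ h
      have hx' : ((x - 1 : ℝ) : ℂ) ≠ 0 := by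
        rw [Complex.ofReal_ne_zero]; linarith
      have e := ih (x - 1) (by linarith) (by push_cast at hx; linarith)
      rw [hankelGamma_eq_mul hc, sub_add_cancel] at e
      have g := Complex.Gamma_add_one _ hx'
      rw [show ((x - 1 : ℝ) : ℂ) + 1 = x by push_cast; ring] at g
      rw [g]
      apply mul_left_cancel₀ hx'
      rw [e]
      field_simp
  obtain ⟨n, hn⟩ := exists_nat_ge x
  exact step n x hx (by linarith)

lemma hasSum_hankelIntegral_geometric {θ : ℝ} (hc : cos θ < 0) (b L : ℝ) {q : ℂ → ℂ}
    (hq : Continuous q) (hq' : ∀ w : ℂ, L ≤ w.re → ‖q w‖ ≤ 1 / 2) :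
    HasSum (fun n : ℕ => hankelIntegral θ L fun w => hankelKernel b w * q w ^ n)
      (hankelIntegral θ L fun w => hankelKernel b w * (1 - q w)⁻¹) := by
  have hK := continuous_hankelKernel b
  have hsum (w : ℂ) (hw : L ≤ w.re) :
      HasSum (fun n : ℕ => hankelKernel b w * q w ^ n) (hankelKernel b w * (1 - q w)⁻¹) :=
    (hasSum_geometric_of_norm_lt_one ((hq' w hw).trans_lt (by norm_num))).mul_left _
  have hbd (n : ℕ) (w : ℂ) (hw : L ≤ w.re) :
      ‖hankelKernel b w * q w ^ n‖ ≤ ‖hankelKernel b w‖ * (1 / 2) ^ n := by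
    rw [norm_mul, norm_pow]
    gcongr
    exact hq' w hw
  have ray (y : ℝ) (hy : cos y < 0) :
      HasSum (fun n : ℕ => ∫ u in Ioi L, hankelKernel b (u + y * I) * q (u + y * I) ^ n)
        (∫ u in Ioi L, hankelKernel b (u + y * I) * (1 - q (u + y * I))⁻¹) := by
    have hL : ∀ᵐ u : ℝ ∂(volume.restrict (Ioi L)), L ≤ ((u : ℂ) + y * I).re := by
      filter_upwards [ae_restrict_mem measurableSet_Ioi] with u hu
      simpa using le_of_lt hu
    refine hasSum_integral_of_dominated_convergence
      (fun n u => ‖hankelKernel b (u + y * I)‖ * (1 / 2) ^ n) ?_ ?_ ?_ ?_ ?_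
    · intro n
      exact Continuous.aestronglyMeasurable (by fun_prop)
    · intro n
      filter_upwards [hL] with u hu using hbd n _ hu
    · exact ae_of_all _ fun u => summable_geometric_two.mul_left _
    · simp only [tsum_mul_left]
      exact (integrableOn_hankelKernel_Ioi hy b L).norm.mul_const _
    · filter_upwards [hL] with u hu using hsum _ hu
  have ver : HasSum (fun n : ℕ => ∫ y in (-θ)..θ, hankelKernel b (L + y * I) * q (L + y * I) ^ n)
      (∫ y in (-θ)..θ, hankelKernel b (L + y * I) * (1 - q (L + y * I))⁻¹) := by
    refine intervalIntegral.hasSum_integral_of_dominated_convergence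
      (fun n y => ‖hankelKernel b (L + y * I)‖ * (1 / 2) ^ n) ?_ ?_ ?_ ?_ ?_
    · intro n
      exact Continuous.aestronglyMeasurable (by fun_prop)
    · exact fun n => ae_of_all _ fun y _ => hbd n _ (by simp)
    · exact ae_of_all _ fun y _ => summable_geometric_two.mul_left _
    · simp only [tsum_mul_left]
      exact Continuous.intervalIntegrable (by fun_prop) _ _
    · exact ae_of_all _ fun y _ => hsum _ (by simp)
  exact ((ray θ hc).sub (ray (-θ) (by rwa [cos_neg]))).add (ver.mul_left I)

/-- Contour integral representation of the Mittag-Leffler function. -/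
lemma hankelIntegral_eq_mittagLeffler {α θ : ℝ} (hα : 0 < α) (hθ₁ : π / 2 < θ) (hθ₂ : θ < π)
    {z : ℂ} {L : ℝ} (hL : ‖z‖ ≤ rexp (α * L) / 2) :
    hankelIntegral θ L
        (fun w => hankelKernel (1 - α) w * (1 - z * Complex.exp (-(α * w)))⁻¹) =
      2 * π * I * mittagLeffler α α z := by
  have hc : cos θ < 0 := cos_neg_of_pi_div_two_lt_of_lt hθ₁ (by linarith)
  have hθ : 0 ≤ θ := by linarith [pi_pos]
  have h := hasSum_hankelIntegral_geometric hc (1 - α) L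
    (q := fun w => z * Complex.exp (-(α * w))) (by fun_prop) (fun w hw => by
      rw [norm_mul, Complex.norm_exp]
      have : (-((α : ℂ) * w)).re ≤ -(α * L) := by
        simpa using mul_le_mul_of_nonneg_left hw hα.le
      calc ‖z‖ * rexp (-((α : ℂ) * w)).re ≤ rexp (α * L) / 2 * rexp (-(α * L)) := by gcongr
        _ = 1 / 2 := by rw [exp_neg]; field_simp)
  have hterm (n : ℕ) :
      (hankelIntegral θ L fun w => hankelKernel (1 - α) w * (z * Complex.exp (-(α * w))) ^ n) =
        2 * π * I * (z ^ n / Complex.Gamma (α * n + α)) := by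
    have e (w : ℂ) : hankelKernel (1 - α) w * (z * Complex.exp (-(α * w))) ^ n =
        z ^ n * hankelKernel (1 - (α * n + α)) w := by
      rw [mul_pow, ← Complex.exp_nat_mul, hankelKernel, hankelKernel, mul_left_comm,
        ← Complex.exp_add]
      congr 2
      push_cast
      ring
    simp only [e]
    rw [hankelIntegral_const_mul, hankelIntegral_kernel_shift hθ hc _ L 0, ← hankelGamma,
      hankelGamma_eq hθ₁ hθ₂ (by positivity)]
    push_cast
    ring
  simp only [hterm] at h
  rw [← h.tsum_eq, tsum_mul_left, mittagLeffler]

lemma hankelIntegral_congr {θ L : ℝ} (hθ : 0 ≤ θ) {f g : ℂ → ℂ}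
    (h : ∀ w : ℂ, |w.im| ≤ θ → f w = g w) : hankelIntegral θ L f = hankelIntegral θ L g := by
  unfold hankelIntegral
  congr 1
  · congr 2 <;> ext u <;> apply h <;> simp [abs_of_nonneg hθ]
  · congr 1
    refine intervalIntegral.integral_congr fun y hy => h _ ?_
    rw [uIcc_of_le (by linarith)] at hy
    simpa using abs_le.2 hy

/-- A bound for the Mittag-Leffler function in terms of the distance of its argument to the sector
swept out by the Hankel contours. -/
lemma norm_mittagLeffler_le {α θ : ℝ} (hα : 0 < α) (hθ₁ : π / 2 < θ) (hθ₂ : θ < π) :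
    ∃ C : ℝ, ∀ (z : ℂ) (δ : ℝ), z ≠ 0 → 0 < δ →
      (∀ w : ℂ, |w.im| ≤ θ → δ ≤ ‖Complex.exp (α * w) - z‖) →
      ‖mittagLeffler α α z‖ ≤ C / (‖z‖ * δ) := by
  have hc : cos θ < 0 := cos_neg_of_pi_div_two_lt_of_lt hθ₁ (by linarith)
  have hc' : cos (-θ) < 0 := by rwa [cos_neg]
  have hθ : 0 ≤ θ := by linarith [pi_pos]
  set J := ∫ u in Ioi (0 : ℝ), kernelBound (cos θ) (1 + α) u
  set M := kernelBound 1 (1 + α) 0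
  refine ⟨(J + J + M * |θ - -θ|) / (2 * π), fun z δ hz hδ hsec => ?_⟩
  have hne (w : ℂ) (hw : |w.im| ≤ θ) : Complex.exp (α * w) - z ≠ 0 := by
    rw [← norm_pos_iff]; exact hδ.trans_le (hsec w hw)
  set g : ℂ → ℂ := fun w => hankelKernel (1 + α) w / (Complex.exp (α * w) - z) with hg
  have hgd (w : ℂ) (hw : |w.im| ≤ θ) : DifferentiableAt ℂ g w :=
    (differentiable_hankelKernel _ w).div (by fun_prop) (hne w hw)
  have hgb (u y : ℝ) (hy : |y| ≤ θ) :
      ‖g (u + y * I)‖ ≤ kernelBound (cos y) (1 + α) u / δ := by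
    rw [hg, norm_div, norm_hankelKernel]
    have := hsec (u + y * I) (by simpa using hy)
    have := kernelBound_pos (cos y) (1 + α) u
    gcongr
  have hgc (γ : ℝ → ℂ) (hγ : Continuous γ) (h : ∀ t, |(γ t).im| ≤ θ) :
      Continuous fun t => g (γ t) :=
    continuous_iff_continuousAt.2 fun t => (hgd _ (h t)).continuousAt.comp hγ.continuousAt
  have hθ' : |θ| ≤ θ := (abs_of_nonneg hθ).le
  have hθ'' : |-θ| ≤ θ := by rwa [abs_neg]
  have ray (y : ℝ) (hy : |y| ≤ θ) (hcy : cos y < 0) (L : ℝ) :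
      IntegrableOn (fun u : ℝ => g (u + y * I)) (Ioi L) := by
    refine ((integrableOn_kernelBound_Ioi hcy (1 + α) L).div_const δ).mono' ?_ ?_
    · exact (hgc _ (by fun_prop) (by simpa using hy)).aestronglyMeasurable
    · exact ae_of_all _ fun u => hgb u y hy
  obtain ⟨L, hL⟩ : ∃ L, ‖z‖ ≤ rexp (α * L) / 2 :=
    ⟨log (2 * ‖z‖) / α, by
      rw [mul_div_cancel₀ _ hα.ne', exp_log (by positivity)]; linarith⟩
  have gint : HankelIntegrable θ L g := by
    refine ⟨ray θ hθ' hc L, ray (-θ) hθ'' hc' L, ContinuousOn.intervalIntegrable ?_⟩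
    intro y hy
    rw [uIcc_of_le (by linarith)] at hy
    refine ContinuousAt.continuousWithinAt ?_
    exact (hgd (L + y * I) (by simpa using abs_le.2 hy)).continuousAt.comp
      (f := fun y : ℝ => (L : ℂ) + y * I) (by fun_prop)
  have rep : 2 * π * I * mittagLeffler α α z = z⁻¹ * hankelIntegral θ 0 g := by
    rw [← hankelIntegral_eq_mittagLeffler hα hθ₁ hθ₂ hL,
      hankelIntegral_congr (g := fun w => -z⁻¹ * hankelKernel (0 + 1) w + z⁻¹ * g w) hθ,
      hankelIntegral_add ((hankelIntegrable_kernel hc _ L).const_mul _) (gint.const_mul _),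
      hankelIntegral_const_mul, hankelIntegral_const_mul, hankelIntegral_kernel_add_one hc,
      hankelIntegral_shift (M := 0) hθ hgd (ray θ hθ' hc) (ray (-θ) hθ'' hc')]
    · simp
    · intro w hw
      have hp : Complex.exp (α * w) ≠ 0 := Complex.exp_ne_zero _
      have h₁ : hankelKernel (0 + 1) w = hankelKernel (1 - α) w * Complex.exp (α * w) := by
        simp only [hankelKernel, ← Complex.exp_add]
        congr 1; push_cast; ring
      have h₂ : hankelKernel (1 + α) w =
          hankelKernel (1 - α) w * Complex.exp (α * w) * Complex.exp (α * w) := by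
        simp only [hankelKernel, ← Complex.exp_add]
        congr 1; push_cast; ring
      have h₃ := hne w hw
      have h₄ : 1 - z * (Complex.exp (α * w))⁻¹ ≠ 0 := by
        intro h
        apply h₃
        field_simp at h
        rwa [mul_zero] at h
      simp only [hg]
      rw [h₁, h₂, Complex.exp_neg]
      field_simp
      ring
  have bray (y : ℝ) (hy : |y| ≤ θ) (hcy : cos y = cos θ) :
      ‖∫ u in Ioi (0 : ℝ), g (u + y * I)‖ ≤ J / δ := by
    rw [← integral_div]
    refine norm_integral_le_of_norm_le ((integrableOn_kernelBound_Ioi hc _ _).div_const δ) ?_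
    exact ae_of_all _ fun u => hcy ▸ hgb u y hy
  have bver : ‖∫ y in (-θ)..θ, g ((0 : ℝ) + y * I)‖ ≤ M / δ * |θ - -θ| := by
    refine intervalIntegral.norm_integral_le_of_norm_le_const fun y hy => ?_
    have hy := uIoc_subset_uIcc hy
    rw [uIcc_of_le (by linarith)] at hy
    refine (hgb 0 y (abs_le.2 hy)).trans ?_
    gcongr
    exact kernelBound_mono (cos_le_one y) _ _
  have bound : ‖hankelIntegral θ 0 g‖ ≤ J / δ + J / δ + M / δ * |θ - -θ| := by
    refine (norm_add_le _ _).trans (add_le_add ((norm_sub_le _ _).trans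
      (add_le_add (bray θ hθ' rfl) (bray (-θ) hθ'' (cos_neg θ)))) ?_)
    rw [norm_mul, Complex.norm_I, one_mul]
    exact bver
  have hn := congrArg norm rep
  simp only [norm_mul, Complex.norm_I, Complex.norm_ofNat, Complex.norm_real, norm_inv, mul_one,
    norm_of_nonneg pi_pos.le] at hn
  have hz' : 0 < ‖z‖ := norm_pos_iff.2 hz
  have : ‖mittagLeffler α α z‖ = ‖z‖⁻¹ * ‖hankelIntegral θ 0 g‖ / (2 * π) := by
    rw [← hn]; field_simp
  rw [this]
  calc _ ≤ ‖z‖⁻¹ * (J / δ + J / δ + M / δ * |θ - -θ|) / (2 * π) := by gcongr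
    _ = _ := by field_simp

/-- A ray outside a closed sector keeps a distance to the sector proportional to the modulus. -/
lemma exists_mul_le_norm_sub {φ₀ ψ : ℝ} (hφ₀ : 0 ≤ φ₀) (h : φ₀ < |ψ|) (hψ : |ψ| ≤ π) :
    ∃ κ : ℝ, 0 < κ ∧ ∀ ρ R φ : ℝ, |φ| ≤ φ₀ → 0 ≤ ρ → 0 ≤ R →
      κ * R ≤ ‖ρ * Complex.exp (φ * I) - R * Complex.exp (ψ * I)‖ := by
  obtain ⟨φ₁, hφ₁, hmin⟩ := (isCompact_Icc (a := -φ₀) (b := φ₀)).exists_isMinOn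
    ⟨0, by simpa using hφ₀⟩ (f := fun φ => 1 - cos (φ - ψ)) (by fun_prop)
  have hpos : 0 < 1 - cos (φ₁ - ψ) := by
    have h₁ := abs_le.2 hφ₁
    have h₂ : |φ₁ - ψ| < 2 * π := (abs_sub _ _).trans_lt (by linarith)
    have h₃ : cos (φ₁ - ψ) ≠ 1 := by
      rw [Ne, cos_eq_one_iff_of_lt_of_lt (abs_lt.1 h₂).1 (abs_lt.1 h₂).2, sub_eq_zero]
      rintro rfl
      linarith
    have := lt_of_le_of_ne (cos_le_one _) h₃
    linarith
  refine ⟨√((1 - cos (φ₁ - ψ)) / 2), by positivity, fun ρ R φ hφ hρ hR => ?_⟩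
  have hm : 1 - cos (φ₁ - ψ) ≤ 1 - cos (φ - ψ) := hmin (abs_le.1 hφ)
  have hnorm : ‖ρ * Complex.exp (φ * I) - R * Complex.exp (ψ * I)‖ ^ 2 =
      ρ ^ 2 - 2 * ρ * R * cos (φ - ψ) + R ^ 2 := by
    rw [← Complex.normSq_eq_norm_sq, Complex.normSq_apply, cos_sub]
    simp only [Complex.sub_re, Complex.sub_im, Complex.re_ofReal_mul, Complex.im_ofReal_mul,
      Complex.exp_ofReal_mul_I_re, Complex.exp_ofReal_mul_I_im]
    linear_combination ρ ^ 2 * sin_sq_add_cos_sq φ + R ^ 2 * sin_sq_add_cos_sq ψ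
  refine le_of_sq_le_sq ?_ (norm_nonneg _)
  rw [hnorm, mul_pow, sq_sqrt (by positivity)]
  have c₁ := cos_le_one (φ - ψ)
  have c₂ := neg_one_le_cos (φ - ψ)
  set c := cos (φ - ψ)
  have hR2 : (1 - cos (φ₁ - ψ)) / 2 * R ^ 2 ≤ (1 - c) / 2 * R ^ 2 := by gcongr
  refine hR2.trans ?_
  nlinarith [mul_nonneg (sub_nonneg.2 c₁) (sq_nonneg (ρ + R)),
    mul_nonneg (by linarith : 0 ≤ 1 + c) (sq_nonneg (ρ - R)), mul_nonneg hρ hR, sq_nonneg ρ]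

end MittagLeffler

/-- For `0 < α < 1` and nonzero `λ ∈ ℂ` with `|arg λ| > απ/2`,
`t^{α−1} E_{α,α}(λ t^α) = O(t^{−1−α})` as `t → ∞`; in particular it tends to `0`. -/
theorem mittagLeffler_kernel_decay (α : ℝ) (hα₀ : 0 < α) (hα₁ : α < 1)
    (lam : ℂ) (hlam : lam ≠ 0) (harg : α * π / 2 < |Complex.arg lam|) :
    (fun t : ℝ => ((t ^ (α - 1) : ℝ) : ℂ) * mittagLeffler α α (lam * ((t ^ α : ℝ) : ℂ)))
        =O[atTop] (fun t : ℝ => t ^ (-1 - α)) ∧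
      Tendsto
        (fun t : ℝ => ((t ^ (α - 1) : ℝ) : ℂ) * mittagLeffler α α (lam * ((t ^ α : ℝ) : ℂ)))
        atTop (nhds 0) := by
  have hO : (fun t : ℝ => ((t ^ (α - 1) : ℝ) : ℂ) *
      mittagLeffler α α (lam * ((t ^ α : ℝ) : ℂ))) =O[atTop] (fun t : ℝ => t ^ (-1 - α)) := by
    obtain ⟨θ, hθ₁, hθ⟩ : ∃ θ, π / 2 < θ ∧ θ < min π (|Complex.arg lam| / α) :=
      exists_between (lt_min (by linarith [pi_pos]) (by rw [lt_div_iff₀ hα₀]; linarith))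
    obtain ⟨hθ₂, hθ₃⟩ := lt_min_iff.1 hθ
    rw [lt_div_iff₀ hα₀] at hθ₃
    have hθ₀ : 0 < θ := by linarith [pi_pos]
    obtain ⟨κ, hκ, hdist⟩ := MittagLeffler.exists_mul_le_norm_sub (φ₀ := θ * α) (by positivity) hθ₃
      (Complex.abs_arg_le_pi lam)
    obtain ⟨C, hC⟩ := MittagLeffler.norm_mittagLeffler_le hα₀ hθ₁ hθ₂
    refine IsBigO.of_bound (C / (‖lam‖ * κ * ‖lam‖)) ?_
    filter_upwards [eventually_gt_atTop 0] with t ht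
    have hlam' : 0 < ‖lam‖ := norm_pos_iff.2 hlam
    have htα : 0 < t ^ α := rpow_pos_of_pos ht α
    have hE := hC (lam * ((t ^ α : ℝ) : ℂ)) (κ * (‖lam‖ * t ^ α))
      (mul_ne_zero hlam (Complex.ofReal_ne_zero.2 htα.ne')) (by positivity) (fun w hw => by
        have e₁ : Complex.exp (α * w) =
            (rexp (α * w.re) : ℂ) * Complex.exp ((α * w.im : ℝ) * Complex.I) := by
          rw [Complex.ofReal_exp, ← Complex.exp_add]
          congr 1
          nth_rewrite 1 [← Complex.re_add_im w]
          push_cast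
          ring
        have e₂ : lam * ((t ^ α : ℝ) : ℂ) =
            ((‖lam‖ * t ^ α : ℝ) : ℂ) * Complex.exp (Complex.arg lam * Complex.I) := by
          nth_rewrite 1 [← Complex.norm_mul_exp_arg_mul_I lam]
          push_cast
          ring
        rw [e₁, e₂]
        refine hdist _ _ _ ?_ (exp_pos _).le (by positivity)
        rw [abs_mul, abs_of_pos hα₀, mul_comm]
        gcongr)
    rw [norm_mul, Complex.norm_real, norm_of_nonneg (by positivity),
      norm_of_nonneg (by positivity)]
    rw [norm_mul, Complex.norm_real, norm_of_nonneg htα.le] at hE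
    have hp : t ^ (α - 1) = t ^ (-1 - α) * (t ^ α * t ^ α) := by
      rw [← rpow_add ht, ← rpow_add ht]
      congr 1
      ring
    calc t ^ (α - 1) * ‖mittagLeffler α α (lam * ((t ^ α : ℝ) : ℂ))‖
        ≤ t ^ (α - 1) * (C / (‖lam‖ * t ^ α * (κ * (‖lam‖ * t ^ α)))) := by gcongr
      _ = C / (‖lam‖ * κ * ‖lam‖) * t ^ (-1 - α) := by
        rw [hp]
        field_simp
  refine ⟨hO, hO.trans_tendsto ?_⟩
  have := tendsto_rpow_neg_atTop (show 0 < 1 + α by linarith)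
  rwa [show -(1 + α) = -1 - α by ring] at this
end
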